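/- arXiv:2404.03983 — 8 statements merged into one kernel-verified Lean document; each statement's English description precedes it below -/
import Mathlib

section
/- Let ω ∈ 𝔚, n ∈ N and d ∈ D. Then there exist d' ∈ D, ω' ∈ 𝔚 and i₁, i₂ ∈ I such that ω n d = i₁ d' ω' i₂ (i.e. ω n d ∈ I d' ω' I). -/
open Matrix

/-- `J = [[0, I_m], [−I_m, 0]]`. -/
def Jmat (m : ℕ) (R : Type*) [CommRing R] :
    Matrix (Fin m ⊕ Fin m) (Fin m ⊕ Fin m) R :=
  Matrix.fromBlocks 0 1 (-1) 0

/-- `Sp_{2m}(R) = {A : A J Aᵀ = J}`. -/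
def SpSet (m : ℕ) (R : Type*) [CommRing R] :
    Set (Matrix (Fin m ⊕ Fin m) (Fin m ⊕ Fin m) R) :=
  {A | A * Jmat m R * Aᵀ = Jmat m R}

/-- The Weyl element `ω_s` of a permutation `s` of `{1,…,m}`: the matrix of the
map `e_i ↦ e_{s(i)}`, `e_i* ↦ e_{s(i)}*` (row vectors act on the right). -/
def permWeyl (m : ℕ) (R : Type*) [CommRing R] (s : Equiv.Perm (Fin m)) :
    Matrix (Fin m ⊕ Fin m) (Fin m ⊕ Fin m) R :=
  Matrix.of fun p q =>
    match p, q with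
    | Sum.inl i, Sum.inl j => if s i = j then 1 else 0
    | Sum.inr i, Sum.inr j => if s i = j then 1 else 0
    | _, _ => 0

/-- The Weyl element `ω_S` of a subset `S ⊆ {1,…,m}`: the matrix of the map
`e_i ↦ −e_i*`, `e_i* ↦ e_i` for `i ∈ S`, identity on the other basis vectors. -/
def signWeyl (m : ℕ) (R : Type*) [CommRing R] (S : Finset (Fin m)) :
    Matrix (Fin m ⊕ Fin m) (Fin m ⊕ Fin m) R :=
  Matrix.of fun p q =>
    match p, q with
    | Sum.inl i, Sum.inl j => if i ∉ S ∧ i = j then 1 else 0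
    | Sum.inl i, Sum.inr j => if i ∈ S ∧ i = j then -1 else 0
    | Sum.inr i, Sum.inl j => if i ∈ S ∧ i = j then 1 else 0
    | Sum.inr i, Sum.inr j => if i ∉ S ∧ i = j then 1 else 0

/-- `𝔚 = {ω_s ω_S}`, a set of representatives for the Weyl group. -/
def WeylSet (m : ℕ) (R : Type*) [CommRing R] :
    Set (Matrix (Fin m ⊕ Fin m) (Fin m ⊕ Fin m) R) :=
  {W | ∃ (s : Equiv.Perm (Fin m)) (S : Finset (Fin m)),
      W = permWeyl m R s * signWeyl m R S}

/-- `B(𝔽₂) = {[[α, αβ], [0, (αᵀ)⁻¹]]}` with `α` unipotent upper triangular and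
`β` symmetric, over `𝔽₂ = ZMod 2`. -/
def BOverF2 (m : ℕ) : Set (Matrix (Fin m ⊕ Fin m) (Fin m ⊕ Fin m) (ZMod 2)) :=
  {A | ∃ α β : Matrix (Fin m) (Fin m) (ZMod 2),
      (∀ i j : Fin m, j < i → α i j = 0) ∧ (∀ i, α i i = 1) ∧ βᵀ = β ∧
      A = Matrix.fromBlocks α (α * β) 0 (αᵀ)⁻¹}

/-- The Iwahori subgroup `I = red₂⁻¹(B(𝔽₂)) ⊆ Sp_{2m}(ℤ)` at the prime 2. -/
def IwahoriSet (m : ℕ) : Set (Matrix (Fin m ⊕ Fin m) (Fin m ⊕ Fin m) ℤ) :=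
  {A | A ∈ SpSet m ℤ ∧ A.map (Int.cast : ℤ → ZMod 2) ∈ BOverF2 m}

/-- `D₀ = {diag(d₁,…,d_m, d₁⁻¹,…,d_m⁻¹) : dᵢ ∈ ℤ_{>0}, d_m | d_{m−1} | ⋯ | d₁}`. -/
def D0Set (m : ℕ) : Set (Matrix (Fin m ⊕ Fin m) (Fin m ⊕ Fin m) ℚ) :=
  {A | ∃ d : Fin m → ℤ, (∀ i, 0 < d i) ∧ (∀ i j : Fin m, i ≤ j → d j ∣ d i) ∧
      A = Matrix.diagonal (Sum.elim (fun i => (d i : ℚ)) fun i => ((d i : ℚ))⁻¹)}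

/-- `N`: integral matrices `[[α, αβ], [0, (αᵀ)⁻¹]]` with `α` unipotent upper
triangular and `β` symmetric. -/
def NSet (m : ℕ) : Set (Matrix (Fin m ⊕ Fin m) (Fin m ⊕ Fin m) ℤ) :=
  {A | ∃ α β : Matrix (Fin m) (Fin m) ℤ,
      (∀ i j : Fin m, j < i → α i j = 0) ∧ (∀ i, α i i = 1) ∧ βᵀ = β ∧
      A = Matrix.fromBlocks α (α * β) 0 (αᵀ)⁻¹}

/-- `D = {ω⁻¹ d ω : d ∈ D₀, ω ∈ 𝔚}`. -/
def DSet (m : ℕ) : Set (Matrix (Fin m ⊕ Fin m) (Fin m ⊕ Fin m) ℚ) :=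
  {A | ∃ d ∈ D0Set m, ∃ w ∈ WeylSet m ℚ, A = w⁻¹ * d * w}

/-- Entrywise cast of an integral matrix to a rational one. -/
def castQ (m : ℕ) (A : Matrix (Fin m ⊕ Fin m) (Fin m ⊕ Fin m) ℤ) :
    Matrix (Fin m ⊕ Fin m) (Fin m ⊕ Fin m) ℚ :=
  A.map (Int.cast : ℤ → ℚ)

namespace SpIwahori

variable {m : ℕ}

section Adjoint

variable {R : Type*} [CommRing R]

lemma Jmat_mul_Jmat : Jmat m R * Jmat m R = -1 := by
  simp [Jmat, Matrix.fromBlocks_multiply, ← Matrix.fromBlocks_one, Matrix.fromBlocks_neg]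

lemma Jmat_transpose : (Jmat m R)ᵀ = -Jmat m R := by
  simp [Jmat, Matrix.fromBlocks_transpose, Matrix.fromBlocks_neg]

/-- The adjoint of `A` with respect to the symplectic form. -/
def adj (A : Matrix (Fin m ⊕ Fin m) (Fin m ⊕ Fin m) R) :
    Matrix (Fin m ⊕ Fin m) (Fin m ⊕ Fin m) R :=
  -(Jmat m R * Aᵀ * Jmat m R)

lemma adj_mul (A B : Matrix (Fin m ⊕ Fin m) (Fin m ⊕ Fin m) R) :
    adj (A * B) = adj B * adj A := by
  have h : adj B * adj A = Jmat m R * Bᵀ * (Jmat m R * Jmat m R) * Aᵀ * Jmat m R := by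
    simp [adj, Matrix.mul_assoc]
  rw [h, Jmat_mul_Jmat, adj, Matrix.transpose_mul]
  simp [Matrix.mul_assoc]

lemma adj_adj (A : Matrix (Fin m ⊕ Fin m) (Fin m ⊕ Fin m) R) : adj (adj A) = A := by
  have h : adj (adj A) = (Jmat m R * Jmat m R) * A * (Jmat m R * Jmat m R) := by
    simp [adj, Matrix.transpose_mul, Jmat_transpose, Matrix.mul_assoc]
  simp [h, Jmat_mul_Jmat]

lemma adj_add (A B : Matrix (Fin m ⊕ Fin m) (Fin m ⊕ Fin m) R) :
    adj (A + B) = adj A + adj B := by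
  simp [adj, Matrix.mul_add, Matrix.add_mul]; abel

lemma adj_one : adj (1 : Matrix (Fin m ⊕ Fin m) (Fin m ⊕ Fin m) R) = 1 := by
  simp [adj, Jmat_mul_Jmat]

lemma mul_adj_eq_smul_iff (A : Matrix (Fin m ⊕ Fin m) (Fin m ⊕ Fin m) R) (μ : R) :
    A * adj A = μ • 1 ↔ A * Jmat m R * Aᵀ = μ • Jmat m R := by
  have h : A * adj A = -(A * Jmat m R * Aᵀ * Jmat m R) := by simp [adj, Matrix.mul_assoc]
  constructor
  · intro hA
    have := congrArg (· * Jmat m R) (h.symm.trans hA)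
    simpa [Matrix.mul_assoc, Jmat_mul_Jmat] using this
  · intro hA
    simp [h, hA, Jmat_mul_Jmat]

lemma mem_SpSet_iff (A : Matrix (Fin m ⊕ Fin m) (Fin m ⊕ Fin m) R) :
    A ∈ SpSet m R ↔ A * adj A = 1 := by
  simpa [SpSet] using (mul_adj_eq_smul_iff A 1).symm

lemma SpSet_mul {A B : Matrix (Fin m ⊕ Fin m) (Fin m ⊕ Fin m) R}
    (hA : A ∈ SpSet m R) (hB : B ∈ SpSet m R) : A * B ∈ SpSet m R := by
  rw [mem_SpSet_iff] at *
  rw [adj_mul, Matrix.mul_assoc, ← Matrix.mul_assoc B, hB, Matrix.one_mul, hA]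

lemma SpSet_inv {A : Matrix (Fin m ⊕ Fin m) (Fin m ⊕ Fin m) R}
    (hA : A ∈ SpSet m R) : A⁻¹ ∈ SpSet m R := by
  rw [mem_SpSet_iff] at *
  rw [Matrix.inv_eq_right_inv hA, adj_adj]
  exact mul_eq_one_comm.mp hA

end Adjoint

/-- The sign of a basis vector: `J e_p = ± e_{p*}`. -/
def sgn : Fin m ⊕ Fin m → ℤ := Sum.elim (fun _ => 1) fun _ => -1

/-- The position of a basis vector in the ordering `e_1, …, e_m, e_m*, …, e_1*`. -/
def rk : Fin m ⊕ Fin m → ℤ := Sum.elim (fun i => (i : ℤ) - m) fun i => (m : ℤ) - i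

lemma sgn_mul_self (p : Fin m ⊕ Fin m) : sgn p * sgn p = 1 := by
  cases p <;> simp [sgn]

lemma sgn_swap (p : Fin m ⊕ Fin m) : sgn p.swap = -sgn p := by
  cases p <;> simp [sgn]

lemma isUnit_sgn (p : Fin m ⊕ Fin m) : IsUnit (sgn p) := by
  cases p <;> simp [sgn]

lemma rk_swap (p : Fin m ⊕ Fin m) : rk p.swap = -rk p := by
  cases p <;> simp [rk]

lemma rk_injective : Function.Injective (rk : Fin m ⊕ Fin m → ℤ) := by
  rintro (i | i) (j | j) h <;> have := i.2 <;> have := j.2 <;> simp [rk] at h ⊢ <;> omega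

lemma swap_ne (p : Fin m ⊕ Fin m) : p.swap ≠ p := by
  cases p <;> simp

lemma swap_eq_iff {p q : Fin m ⊕ Fin m} : p.swap = q ↔ p = q.swap :=
  ⟨fun h => by simp [← h], fun h => by simp [h]⟩

lemma adj_apply (A : Matrix (Fin m ⊕ Fin m) (Fin m ⊕ Fin m) ℤ) (p q : Fin m ⊕ Fin m) :
    adj A p q = sgn p * sgn q * A q.swap p.swap := by
  rw [← Matrix.fromBlocks_toBlocks A]
  rcases p with i | i <;> rcases q with j | j <;>
    simp [adj, Jmat, sgn, Matrix.fromBlocks_transpose, Matrix.fromBlocks_multiply]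

lemma dvd_adj_apply_iff (A : Matrix (Fin m ⊕ Fin m) (Fin m ⊕ Fin m) ℤ)
    (p q : Fin m ⊕ Fin m) (n : ℤ) : n ∣ adj A p q ↔ n ∣ A q.swap p.swap := by
  rw [adj_apply]
  exact ((isUnit_sgn p).mul (isUnit_sgn q)).dvd_mul_left

lemma natAbs_adj_apply (A : Matrix (Fin m ⊕ Fin m) (Fin m ⊕ Fin m) ℤ)
    (p q : Fin m ⊕ Fin m) : (adj A p q).natAbs = (A q.swap p.swap).natAbs := by
  rw [adj_apply]
  rcases p with i | i <;> rcases q with j | j <;> simp [sgn]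

lemma adj_apply_eq_zero_iff (A : Matrix (Fin m ⊕ Fin m) (Fin m ⊕ Fin m) ℤ)
    (p q : Fin m ⊕ Fin m) : adj A p q = 0 ↔ A q.swap p.swap = 0 := by
  rw [← Int.natAbs_eq_zero, natAbs_adj_apply, Int.natAbs_eq_zero]

/-- Membership in the Iwahori subgroup, for matrices acting as the identity outside the
coordinates in `Q`. -/
structure IsIwahoriOn (Q : Finset (Fin m ⊕ Fin m))
    (A : Matrix (Fin m ⊕ Fin m) (Fin m ⊕ Fin m) ℤ) : Prop where
  mul_adj : A * adj A = 1
  lower : ∀ p q, rk q < rk p → 2 ∣ A p q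
  diag : ∀ p, ¬ 2 ∣ A p p
  outside : ∀ p q, p ∉ Q ∨ q ∉ Q → A p q = (1 : Matrix _ _ ℤ) p q

namespace IsIwahoriOn

variable {P Q : Finset (Fin m ⊕ Fin m)} {A B : Matrix (Fin m ⊕ Fin m) (Fin m ⊕ Fin m) ℤ}

lemma one : IsIwahoriOn Q (1 : Matrix (Fin m ⊕ Fin m) (Fin m ⊕ Fin m) ℤ) where
  mul_adj := by simp [adj_one]
  lower p q h := by
    rw [Matrix.one_apply_ne]
    · simp
    · rintro rfl; exact lt_irrefl _ h
  diag p := by simp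
  outside _ _ _ := rfl

lemma mono (h : P ⊆ Q) (hA : IsIwahoriOn P A) : IsIwahoriOn Q A :=
  ⟨hA.mul_adj, hA.lower, hA.diag, fun p q hpq =>
    hA.outside p q (hpq.imp (fun hp hp' => hp (h hp')) fun hq hq' => hq (h hq'))⟩

lemma mul (hA : IsIwahoriOn Q A) (hB : IsIwahoriOn Q B) : IsIwahoriOn Q (A * B) where
  mul_adj := (mem_SpSet_iff _).1 <|
    SpSet_mul ((mem_SpSet_iff _).2 hA.mul_adj) ((mem_SpSet_iff _).2 hB.mul_adj)
  lower p q h := by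
    rw [Matrix.mul_apply]
    refine Finset.dvd_sum fun k _ => ?_
    rcases lt_or_ge (rk k) (rk p) with hk | hk
    · exact (hA.lower p k hk).mul_right _
    · exact (hB.lower k q (h.trans_le hk)).mul_left _
  diag p := by
    rw [Matrix.mul_apply, ← Finset.add_sum_erase _ _ (Finset.mem_univ p), Int.dvd_add_left]
    · intro h
      rcases Int.prime_two.dvd_or_dvd h with h | h
      exacts [hA.diag p h, hB.diag p h]
    · refine Finset.dvd_sum fun k hk => ?_
      have hne := fun e => (Finset.ne_of_mem_erase hk) (rk_injective e)
      rcases lt_or_gt_of_ne hne with hk | hk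
      · exact (hA.lower p k hk).mul_right _
      · exact (hB.lower k p hk).mul_left _
  outside p q h := by
    rcases h with h | h
    · have : ∀ k, A p k = (1 : Matrix _ _ ℤ) p k := fun k => hA.outside p k (Or.inl h)
      rw [Matrix.mul_apply]
      simp only [this]
      rw [← Matrix.mul_apply, Matrix.one_mul, hB.outside p q (Or.inl h)]
    · have : ∀ k, B k q = (1 : Matrix _ _ ℤ) k q := fun k => hB.outside k q (Or.inr h)
      rw [Matrix.mul_apply]
      simp only [this]
      rw [← Matrix.mul_apply, Matrix.mul_one, hA.outside p q (Or.inr h)]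

lemma adj_mul_self (hA : IsIwahoriOn Q A) : adj A * A = 1 :=
  mul_eq_one_comm.mp hA.mul_adj

lemma adj_mem (hQ : ∀ q ∈ Q, q.swap ∈ Q) (hA : IsIwahoriOn Q A) : IsIwahoriOn Q (adj A) where
  mul_adj := by rw [adj_adj, hA.adj_mul_self]
  lower p q h := by
    rw [dvd_adj_apply_iff]
    exact hA.lower _ _ (by simpa [rk_swap] using h)
  diag p := by
    rw [dvd_adj_apply_iff]
    exact hA.diag _
  outside p q h := by
    have hQ' : ∀ q, q ∉ Q → q.swap ∉ Q := fun q hq hq' => hq (by simpa using hQ _ hq')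
    rw [adj_apply, hA.outside _ _ (h.symm.imp (hQ' _) (hQ' _))]
    by_cases hpq : p = q
    · subst hpq
      rw [sgn_mul_self, one_mul, Matrix.one_apply_eq, Matrix.one_apply_eq]
    · rw [Matrix.one_apply_ne hpq, Matrix.one_apply_ne, mul_zero]
      exact fun e => hpq (by simpa using congrArg Sum.swap e.symm)

end IsIwahoriOn

/-- The nilpotent part of `siegel b u`. -/
def siegelNil (b : Fin m ⊕ Fin m) (u : Fin m ⊕ Fin m → ℤ) :
    Matrix (Fin m ⊕ Fin m) (Fin m ⊕ Fin m) ℤ :=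
  Matrix.of fun p q => (if p = b ∧ q ≠ b then u q else 0) +
    if q = b.swap ∧ p ≠ b ∧ p ≠ b.swap then sgn p * sgn b * u p.swap else 0

/-- The symplectic matrix which maps `e_b` to `e_b + ∑_{q ≠ b} u_q e_q`, fixes `e_{b*}`, and
changes the other basis vectors by multiples of `e_{b*}`. -/
def siegel (b : Fin m ⊕ Fin m) (u : Fin m ⊕ Fin m → ℤ) :
    Matrix (Fin m ⊕ Fin m) (Fin m ⊕ Fin m) ℤ :=
  1 + siegelNil b u

lemma siegelNil_eq (b : Fin m ⊕ Fin m) (u : Fin m ⊕ Fin m → ℤ) :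
    siegelNil b u = Matrix.vecMulVec (Pi.single b 1) (fun q => if q ≠ b then u q else 0) +
      Matrix.vecMulVec
        (fun p => if p ≠ b ∧ p ≠ b.swap then sgn p * sgn b * u p.swap else 0)
        (Pi.single b.swap 1) := by
  ext p q
  by_cases hp : p = b <;> by_cases hq : q = b.swap <;>
    simp [siegelNil, Matrix.vecMulVec_apply, hp, hq]

lemma siegelNil_mul_self (b : Fin m ⊕ Fin m) (u : Fin m ⊕ Fin m → ℤ) :
    siegelNil b u * siegelNil b u = 0 := by
  have key : (fun q => if q ≠ b then u q else 0) ⬝ᵥ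
      (fun p => if p ≠ b ∧ p ≠ b.swap then sgn p * sgn b * u p.swap else 0) = 0 := by
    rw [dotProduct]
    set f : Fin m ⊕ Fin m → ℤ := fun k => (if k ≠ b then u k else 0) *
      (if k ≠ b ∧ k ≠ b.swap then sgn k * sgn b * u k.swap else 0) with hf
    have h1 : ∑ k, f (Equiv.sumComm _ _ k) = ∑ k, f k := Equiv.sum_comp _ f
    have h2 : ∀ k, f (Equiv.sumComm _ _ k) = -f k := by
      intro k
      simp only [hf, Equiv.sumComm_apply]
      by_cases h : k = b
      · subst h; simp
      · by_cases h' : k = b.swap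
        · subst h'; simp
        · have h3 : k.swap ≠ b := fun e => h' (swap_eq_iff.1 e)
          have h4 : k.swap ≠ b.swap := fun e => h (by simpa using congrArg Sum.swap e)
          simp only [ne_eq, h, h', h3, h4, not_false_eq_true, and_self, if_true, sgn_swap,
            Sum.swap_swap]
          ring
    simp only [h2, Finset.sum_neg_distrib] at h1
    linarith
  rw [siegelNil_eq]
  simp only [Matrix.add_mul, Matrix.mul_add, Matrix.vecMulVec_mul_vecMulVec, key]
  simp [(swap_ne b).symm, swap_ne b]

lemma adj_siegelNil (b : Fin m ⊕ Fin m) (u : Fin m ⊕ Fin m → ℤ) :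
    adj (siegelNil b u) = -siegelNil b u := by
  ext p q
  rw [adj_apply, Matrix.neg_apply]
  simp only [siegelNil, Matrix.of_apply, swap_eq_iff, ne_eq, Sum.swap_swap]
  have hb := swap_ne b
  have hs := sgn_mul_self b
  have hp := sgn_mul_self p
  have hq := sgn_mul_self q
  have hb' := sgn_swap b
  have hq' := sgn_swap q
  by_cases h1 : p = b
  · subst h1
    by_cases h2 : q = p.swap
    · subst h2
      simp [hb, hb.symm, hb']
      linear_combination u p.swap * hp
    · by_cases h3 : q = p
      · subst h3
        simp [hb.symm]
      · simp [h2, h3, hb.symm, hq']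
        linear_combination u q * sgn p * sgn p * hq + u q * hp
  · by_cases h2 : q = b.swap
    · subst h2
      by_cases h3 : p = b.swap
      · subst h3; simp [h1]
      · simp [h1, h3, hb, hb']
    · simp [h1, h2]

lemma siegel_mul_adj (b : Fin m ⊕ Fin m) (u : Fin m ⊕ Fin m → ℤ) :
    siegel b u * adj (siegel b u) = 1 := by
  rw [siegel, adj_add, adj_one, adj_siegelNil, Matrix.add_mul, Matrix.mul_add, Matrix.mul_add,
    Matrix.mul_neg, Matrix.mul_neg, siegelNil_mul_self]
  simp

lemma siegel_mem {Q : Finset (Fin m ⊕ Fin m)} (hQ : ∀ q ∈ Q, q.swap ∈ Q) {b : Fin m ⊕ Fin m}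
    (hb : b ∈ Q) {u : Fin m ⊕ Fin m → ℤ} (hu : ∀ q, q ∉ Q → u q = 0)
    (hu2 : ∀ q, rk q < rk b → 2 ∣ u q) : IsIwahoriOn Q (siegel b u) where
  mul_adj := siegel_mul_adj b u
  lower p q h := by
    have hpq : p ≠ q := by rintro rfl; exact lt_irrefl _ h
    rw [siegel, Matrix.add_apply, Matrix.one_apply_ne hpq, zero_add, siegelNil, Matrix.of_apply]
    refine dvd_add ?_ ?_ <;> split_ifs with h1
    · exact hu2 _ (h1.1 ▸ h)
    · simp
    · refine (hu2 _ ?_).mul_left _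
      rw [h1.1, rk_swap] at h
      rw [rk_swap]
      linarith
    · simp
  diag p := by
    have : siegelNil b u p p = 0 := by
      simp only [siegelNil, Matrix.of_apply]
      rw [if_neg (by tauto), if_neg (by tauto), add_zero]
    simp [siegel, this]
  outside p q h := by
    rw [siegel, Matrix.add_apply, add_eq_left, siegelNil, Matrix.of_apply]
    rcases h with h | h
    · have h1 : p ≠ b := by rintro rfl; exact h hb
      have h2 : u p.swap = 0 := hu _ fun h' => h (by simpa using hQ _ h')
      simp [h1, h2]
    · have h1 : q ≠ b.swap := by rintro rfl; exact h (hQ _ hb)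
      simp [h1, hu _ h]

lemma siegel_row (b : Fin m ⊕ Fin m) (u : Fin m ⊕ Fin m → ℤ) (q : Fin m ⊕ Fin m) :
    siegel b u b q = if q = b then 1 else u q := by
  by_cases h : q = b
  · simp [siegel, siegelNil, h]
  · simp [siegel, siegelNil, h, Ne.symm h]

lemma siegel_col (b : Fin m ⊕ Fin m) (u : Fin m ⊕ Fin m → ℤ) (p : Fin m ⊕ Fin m) :
    siegel b u p b = (1 : Matrix (Fin m ⊕ Fin m) (Fin m ⊕ Fin m) ℤ) p b := by
  simp [siegel, siegelNil, (swap_ne b).symm]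

lemma siegel_single_col {b q : Fin m ⊕ Fin m} (h : q ≠ b) (t : ℤ) (p : Fin m ⊕ Fin m) :
    siegel b (Pi.single q t) p q =
      (1 : Matrix (Fin m ⊕ Fin m) (Fin m ⊕ Fin m) ℤ) p q + if p = b then t else 0 := by
  have h2 : (Pi.single q t : Fin m ⊕ Fin m → ℤ) p.swap = if p = q.swap then t else 0 := by
    simp [Pi.single_apply, swap_eq_iff]
  by_cases hp : p = b
  · subst hp
    simp [siegel, siegelNil, h]
  · by_cases hq : q = b.swap
    · by_cases hp' : p = q.swap
      · exact absurd (by simp [hp', hq]) hp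
      · simp [siegel, siegelNil, h2, hp, hp']
    · simp [siegel, siegelNil, hp, hq]

lemma two_dvd_siegel {b : Fin m ⊕ Fin m} {u : Fin m ⊕ Fin m → ℤ} (hu : ∀ q, 2 ∣ u q)
    (p q : Fin m ⊕ Fin m) :
    2 ∣ siegel b u p q - (1 : Matrix (Fin m ⊕ Fin m) (Fin m ⊕ Fin m) ℤ) p q := by
  rw [siegel, Matrix.add_apply, add_sub_cancel_left, siegelNil, Matrix.of_apply]
  refine dvd_add ?_ ?_ <;> split_ifs
  exacts [hu _, dvd_zero _, (hu _).mul_left _, dvd_zero _]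

/-- `h` is a symplectic similitude of multiplier `μ` which respects the decomposition of the
coordinates given by `P` on rows and `Q` on columns. -/
structure IsBlock (P Q : Finset (Fin m ⊕ Fin m)) (h : Matrix (Fin m ⊕ Fin m) (Fin m ⊕ Fin m) ℤ)
    (μ : ℤ) : Prop where
  swap_row : ∀ p ∈ P, p.swap ∈ P
  swap_col : ∀ q ∈ Q, q.swap ∈ Q
  zero : ∀ p q, ¬(p ∈ P ↔ q ∈ Q) → h p q = 0
  mul_adj : h * adj h = μ • (1 : Matrix _ _ ℤ)
  adj_mul : adj h * h = μ • (1 : Matrix _ _ ℤ)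

lemma swap_mem_iff {P : Finset (Fin m ⊕ Fin m)} (hP : ∀ p ∈ P, p.swap ∈ P)
    (p : Fin m ⊕ Fin m) : p.swap ∈ P ↔ p ∈ P :=
  ⟨fun h => by simpa using hP _ h, hP p⟩

section Pivot

variable {P Q : Finset (Fin m ⊕ Fin m)} {h A B : Matrix (Fin m ⊕ Fin m) (Fin m ⊕ Fin m) ℤ}
  {μ T : ℤ} {a b : Fin m ⊕ Fin m}

namespace IsBlock

lemma adj (hh : IsBlock P Q h μ) : IsBlock Q P (adj h) μ where
  swap_row := hh.swap_col
  swap_col := hh.swap_row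
  zero p q hpq := by
    rw [adj_apply_eq_zero_iff]
    refine hh.zero _ _ ?_
    rw [swap_mem_iff hh.swap_row, swap_mem_iff hh.swap_col]
    tauto
  mul_adj := by rw [adj_adj]; exact hh.adj_mul
  adj_mul := by rw [adj_adj]; exact hh.mul_adj

lemma mul_right (hh : IsBlock P Q h μ) (hA : IsIwahoriOn Q A) : IsBlock P Q (h * A) μ where
  swap_row := hh.swap_row
  swap_col := hh.swap_col
  zero p q hpq := by
    rw [Matrix.mul_apply]
    refine Finset.sum_eq_zero fun k _ => ?_
    by_cases hk : p ∈ P ↔ k ∈ Q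
    · have hkq : k ≠ q := by rintro rfl; exact hpq hk
      rw [hA.outside k q (by tauto), Matrix.one_apply_ne hkq, mul_zero]
    · rw [hh.zero _ _ hk, zero_mul]
  mul_adj := by
    rw [SpIwahori.adj_mul, Matrix.mul_assoc, ← Matrix.mul_assoc A, hA.mul_adj, Matrix.one_mul,
      hh.mul_adj]
  adj_mul := by
    rw [SpIwahori.adj_mul, Matrix.mul_assoc, ← Matrix.mul_assoc _ h, hh.adj_mul]
    rw [Matrix.smul_mul, Matrix.one_mul, Matrix.mul_smul, hA.adj_mul_self]

lemma mul_left (hh : IsBlock P Q h μ) (hA : IsIwahoriOn P A) : IsBlock P Q (A * h) μ := by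
  simpa [SpIwahori.adj_mul, adj_adj] using (hh.adj.mul_right (hA.adj_mem hh.swap_row)).adj

lemma dvd_mul_right (hh : IsBlock P Q h μ) (hT : ∀ p ∈ P, ∀ q ∈ Q, T ∣ h p q)
    (A : Matrix (Fin m ⊕ Fin m) (Fin m ⊕ Fin m) ℤ) {p : Fin m ⊕ Fin m} (hp : p ∈ P)
    (q : Fin m ⊕ Fin m) : T ∣ (h * A) p q := by
  rw [Matrix.mul_apply]
  refine Finset.dvd_sum fun k _ => ?_
  by_cases hk : k ∈ Q
  · exact (hT p hp k hk).mul_right _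
  · rw [hh.zero p k (by tauto), zero_mul]
    exact dvd_zero _

lemma dvd_mul_left (hh : IsBlock P Q h μ) (hT : ∀ p ∈ P, ∀ q ∈ Q, T ∣ h p q)
    (A : Matrix (Fin m ⊕ Fin m) (Fin m ⊕ Fin m) ℤ) (p : Fin m ⊕ Fin m) {q : Fin m ⊕ Fin m}
    (hq : q ∈ Q) : T ∣ (A * h) p q := by
  rw [Matrix.mul_apply]
  refine Finset.dvd_sum fun k _ => ?_
  by_cases hk : k ∈ P
  · exact (hT k hk q hq).mul_left _
  · rw [hh.zero k q (by tauto), mul_zero]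
    exact dvd_zero _

lemma dvd_mul_mul (hh : IsBlock P Q h μ) (hT : ∀ p ∈ P, ∀ q ∈ Q, T ∣ h p q)
    (hA : IsIwahoriOn P A) (B : Matrix (Fin m ⊕ Fin m) (Fin m ⊕ Fin m) ℤ) :
    ∀ p ∈ P, ∀ q ∈ Q, T ∣ (A * h * B) p q := fun _ hp q _ =>
  (hh.mul_left hA).dvd_mul_right (fun p _ _ hq => hh.dvd_mul_left hT A p hq) B hp q

end IsBlock

/-- `(a, b)` is an admissible pivot position of the block of `h` with rows in `P` and columns in
`Q`, where `T` is the largest power of `2` dividing this block. -/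
structure IsPivot (T : ℤ) (P Q : Finset (Fin m ⊕ Fin m))
    (h : Matrix (Fin m ⊕ Fin m) (Fin m ⊕ Fin m) ℤ) (a b : Fin m ⊕ Fin m) : Prop where
  mem_row : a ∈ P
  mem_col : b ∈ Q
  dvd : ∀ p ∈ P, ∀ q ∈ Q, T ∣ h p q
  not_dvd : ¬ 2 * T ∣ h a b
  row : ∀ q ∈ Q, rk q < rk b → 2 * T ∣ h a q
  col : ∀ p ∈ P, rk a < rk p → 2 * T ∣ h p b

namespace IsPivot

lemma adj (hh : IsBlock P Q h μ) (hp : IsPivot T P Q h a b) :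
    IsPivot T Q P (adj h) b.swap a.swap where
  mem_row := hh.swap_col _ hp.mem_col
  mem_col := hh.swap_row _ hp.mem_row
  dvd p hpQ q hqP := by
    rw [dvd_adj_apply_iff]
    exact hp.dvd _ (hh.swap_row _ hqP) _ (hh.swap_col _ hpQ)
  not_dvd := by
    rw [dvd_adj_apply_iff]
    simpa using hp.not_dvd
  row q hq hlt := by
    rw [dvd_adj_apply_iff]
    simp only [rk_swap, Sum.swap_swap] at *
    exact hp.col _ (hh.swap_row _ hq) (by rw [rk_swap]; linarith)
  col q hq hlt := by
    rw [dvd_adj_apply_iff]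
    simp only [rk_swap, Sum.swap_swap] at *
    exact hp.row _ (hh.swap_col _ hq) (by rw [rk_swap]; linarith)

lemma mul_right (hh : IsBlock P Q h μ) (hp : IsPivot T P Q h a b)
    (hA : ∀ p q, 2 ∣ A p q - (1 : Matrix (Fin m ⊕ Fin m) (Fin m ⊕ Fin m) ℤ) p q) :
    IsPivot T P Q (h * A) a b := by
  have key : ∀ p ∈ P, ∀ q, 2 * T ∣ (h * A) p q - h p q := by
    intro p hpP q
    have : (h * A) p q - h p q = (h * (A - 1)) p q := by
      rw [Matrix.mul_sub, Matrix.mul_one, Matrix.sub_apply]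
    rw [this, Matrix.mul_apply]
    refine Finset.dvd_sum fun k _ => ?_
    by_cases hk : k ∈ Q
    · rw [mul_comm (h p k)]
      exact mul_dvd_mul (hA k q) (hp.dvd p hpP k hk)
    · rw [hh.zero p k (by tauto), zero_mul]
      exact dvd_zero _
  refine ⟨hp.mem_row, hp.mem_col, fun p hpP q _ => hh.dvd_mul_right hp.dvd A hpP q, ?_, ?_, ?_⟩
  · exact fun hd => hp.not_dvd ((dvd_iff_dvd_of_dvd_sub (key a hp.mem_row b)).1 hd)
  · exact fun q hq hlt => (dvd_iff_dvd_of_dvd_sub (key a hp.mem_row q)).2 (hp.row q hq hlt)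
  · exact fun p hpP hlt => (dvd_iff_dvd_of_dvd_sub (key p hpP b)).2 (hp.col p hpP hlt)

lemma mul_left (hh : IsBlock P Q h μ) (hp : IsPivot T P Q h a b)
    (hA : ∀ p q, 2 ∣ A p q - (1 : Matrix (Fin m ⊕ Fin m) (Fin m ⊕ Fin m) ℤ) p q)
    (hAP : IsIwahoriOn P A) : IsPivot T P Q (A * h) a b := by
  have hA' : ∀ p q, 2 ∣ SpIwahori.adj A p q -
      (1 : Matrix (Fin m ⊕ Fin m) (Fin m ⊕ Fin m) ℤ) p q := by
    intro p q
    have h1 : SpIwahori.adj (A - 1) = SpIwahori.adj A - 1 := by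
      have := adj_add (A - 1) (1 : Matrix (Fin m ⊕ Fin m) (Fin m ⊕ Fin m) ℤ)
      rw [sub_add_cancel, adj_one] at this
      rw [this, add_sub_cancel_right]
    rw [← Matrix.sub_apply, ← h1, dvd_adj_apply_iff]
    exact hA _ _
  have := ((hp.adj hh).mul_right hh.adj hA').adj (hh.adj.mul_right (hAP.adj_mem hh.swap_row))
  simpa [adj_mul, adj_adj] using this

end IsPivot

/-- An admissible pivot whose absolute value cannot be decreased by Iwahori matrices. -/
structure IsMinPivot (T : ℤ) (P Q : Finset (Fin m ⊕ Fin m))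
    (h : Matrix (Fin m ⊕ Fin m) (Fin m ⊕ Fin m) ℤ) (a b : Fin m ⊕ Fin m) : Prop
    extends IsPivot T P Q h a b where
  natAbs_le : ∀ A B, IsIwahoriOn P A → IsIwahoriOn Q B → IsPivot T P Q (A * h * B) a b →
    (h a b).natAbs ≤ ((A * h * B) a b).natAbs

lemma exists_abs_add_two_mul_le {x : ℤ} (hx : x ≠ 0) (y : ℤ) :
    ∃ t : ℤ, (y + 2 * t * x).natAbs ≤ x.natAbs := by
  have h0 : 0 < 2 * x.natAbs := by omega
  have h1 := Int.bmod_add_bdiv y (2 * x.natAbs)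
  have h2 := Int.le_bmod (x := y) h0
  have h3 := Int.bmod_le (x := y) h0
  rcases Int.natAbs_eq x with hx' | hx' <;> rw [Int.natCast_natAbs] at hx'
  · refine ⟨-y.bdiv (2 * x.natAbs), ?_⟩
    have : y + 2 * -y.bdiv (2 * x.natAbs) * x = y.bmod (2 * x.natAbs) := by
      push_cast at h1 ⊢
      linear_combination -h1 - 2 * y.bdiv (2 * x.natAbs) * hx'
    rw [this]
    omega
  · refine ⟨y.bdiv (2 * x.natAbs), ?_⟩
    have : y + 2 * y.bdiv (2 * x.natAbs) * x = y.bmod (2 * x.natAbs) := by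
      push_cast at h1 ⊢
      linear_combination -h1 + 2 * y.bdiv (2 * x.natAbs) * hx'
    rw [this]
    omega

namespace IsMinPivot

lemma adj (hh : IsBlock P Q h μ) (hp : IsMinPivot T P Q h a b) :
    IsMinPivot T Q P (adj h) b.swap a.swap where
  toIsPivot := hp.toIsPivot.adj hh
  natAbs_le A B hA hB hpAB := by
    have hA' := hA.adj_mem hh.swap_col
    have hB' := hB.adj_mem hh.swap_row
    have h1 : A * SpIwahori.adj h * B =
        SpIwahori.adj (SpIwahori.adj B * h * SpIwahori.adj A) := by
      simp [adj_mul, adj_adj, Matrix.mul_assoc]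
    have h2 := hpAB.adj ((hh.adj.mul_left hA).mul_right hB)
    rw [h1, adj_adj, Sum.swap_swap, Sum.swap_swap] at h2
    rw [h1, natAbs_adj_apply, natAbs_adj_apply, Sum.swap_swap, Sum.swap_swap]
    exact hp.natAbs_le _ _ hB' hA' h2

lemma of_natAbs_eq (hp : IsMinPivot T P Q h a b) (hA : IsIwahoriOn P A) (hB : IsIwahoriOn Q B)
    (hpAB : IsPivot T P Q (A * h * B) a b) (he : (A * h * B) a b = h a b) :
    IsMinPivot T P Q (A * h * B) a b where
  toIsPivot := hpAB
  natAbs_le A' B' hA' hB' hp' := by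
    have h1 : A' * (A * h * B) * B' = (A' * A) * h * (B * B') := by simp [Matrix.mul_assoc]
    rw [h1] at hp' ⊢
    rw [he]
    exact hp.natAbs_le _ _ (hA'.mul hA) (hB.mul hB') hp'

lemma ne_zero (hp : IsMinPivot T P Q h a b) : h a b ≠ 0 := fun h0 =>
  hp.not_dvd (h0 ▸ dvd_zero _)

lemma siegel_single_mem {b q : Fin m ⊕ Fin m} (hQ : ∀ q ∈ Q, q.swap ∈ Q) (hb : b ∈ Q)
    (hq : q ∈ Q) (t : ℤ) : IsIwahoriOn Q (siegel b (Pi.single q (2 * t))) ∧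
      ∀ i j, 2 ∣ siegel b (Pi.single q (2 * t)) i j -
        (1 : Matrix (Fin m ⊕ Fin m) (Fin m ⊕ Fin m) ℤ) i j := by
  have h2 : ∀ k, 2 ∣ (Pi.single q (2 * t) : Fin m ⊕ Fin m → ℤ) k := by
    intro k
    rw [Pi.single_apply]
    split_ifs <;> simp
  refine ⟨siegel_mem hQ hb (fun k hk => ?_) fun k _ => h2 k, two_dvd_siegel h2⟩
  rw [Pi.single_eq_of_ne]
  rintro rfl
  exact hk hq

lemma mul_siegel_single_same (h : Matrix (Fin m ⊕ Fin m) (Fin m ⊕ Fin m) ℤ)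
    (u : Fin m ⊕ Fin m → ℤ) (a b : Fin m ⊕ Fin m) : (h * siegel b u) a b = h a b := by
  rw [Matrix.mul_apply]
  simp only [siegel_col]
  rw [← Matrix.mul_apply, Matrix.mul_one]

lemma mul_siegel_single (h : Matrix (Fin m ⊕ Fin m) (Fin m ⊕ Fin m) ℤ)
    {b q : Fin m ⊕ Fin m} (hq : q ≠ b) (t : ℤ) (a : Fin m ⊕ Fin m) :
    (h * siegel b (Pi.single q t)) a q = h a q + t * h a b := by
  rw [Matrix.mul_apply]
  simp only [siegel_single_col hq, mul_add, Finset.sum_add_distrib]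
  rw [← Matrix.mul_apply, Matrix.mul_one]
  simp [mul_comm]

lemma row_dvd (hh : IsBlock P Q h μ) (hp : IsMinPivot T P Q h a b) {q : Fin m ⊕ Fin m}
    (hq : q ∈ Q) : h a b ∣ h a q := by
  by_cases hqb : q = b
  · rw [hqb]
  obtain ⟨t, ht⟩ := exists_abs_add_two_mul_le hp.ne_zero (h a q)
  obtain ⟨hE, hE2⟩ := siegel_single_mem hh.swap_col hp.mem_col hq t
  set E := siegel b (Pi.single q (2 * t)) with hEdef
  set y := h a q + 2 * t * h a b with hy
  have e1 : (h * E) a q = y := mul_siegel_single h hqb _ a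
  have e2 : (h * E) a b = h a b := mul_siegel_single_same h _ a b
  suffices hs : h a b ∣ y by
    have := dvd_sub hs (dvd_mul_left (h a b) (2 * t))
    rwa [hy, add_sub_cancel_right] at this
  by_cases hy0 : y = 0
  · rw [hy0]; exact dvd_zero _
  obtain ⟨t', ht'⟩ := exists_abs_add_two_mul_le hy0 (h a b)
  obtain ⟨hF, hF2⟩ := siegel_single_mem hh.swap_col hq hp.mem_col t'
  set F := siegel q (Pi.single b (2 * t')) with hFdef
  have e3 : (h * E * F) a b = h a b + 2 * t' * y := by
    rw [hFdef, mul_siegel_single _ (Ne.symm hqb), e1, e2]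
  have hpiv : IsPivot T P Q (h * E * F) a b :=
    (hp.toIsPivot.mul_right hh hE2).mul_right (hh.mul_right hE) hF2
  have := hp.natAbs_le 1 (E * F) .one (hE.mul hF) (by rwa [Matrix.one_mul, ← Matrix.mul_assoc])
  rw [Matrix.one_mul, ← Matrix.mul_assoc, e3] at this
  exact Int.natAbs_dvd_natAbs.1 (by rw [le_antisymm ht (this.trans ht')])

end IsMinPivot

end Pivot

lemma two_dvd_of_two_mul_dvd {T x u : ℤ} (hT : T ∣ x) (hx : ¬ 2 * T ∣ x)
    (h : 2 * T ∣ x * u) : 2 ∣ u := by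
  obtain ⟨y, rfl⟩ := hT
  have hT0 : T ≠ 0 := by rintro rfl; simp at hx
  rw [mul_comm 2 T] at h hx
  rw [mul_assoc] at h
  have h1 := Int.dvd_of_mul_dvd_mul_left hT0 h
  rcases Int.prime_two.dvd_or_dvd h1 with h2 | h2
  · exact absurd (mul_dvd_mul_left T h2) hx
  · exact h2

section Clear

variable {P Q : Finset (Fin m ⊕ Fin m)} {h A B : Matrix (Fin m ⊕ Fin m) (Fin m ⊕ Fin m) ℤ}
  {μ T : ℤ} {a b : Fin m ⊕ Fin m}

namespace IsMinPivot

lemma exists_clear_row (hh : IsBlock P Q h μ) (hp : IsMinPivot T P Q h a b) :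
    ∃ B, IsIwahoriOn Q B ∧ IsMinPivot T P Q (h * B) a b ∧ (∀ q ≠ b, (h * B) a q = 0) ∧
      ∀ p, (h * B) p b = h p b := by
  set u : Fin m ⊕ Fin m → ℤ := fun q => if q ∈ Q then h a q / h a b else 0 with hu
  have hxu : ∀ q, h a b * u q = h a q := by
    intro q
    by_cases hq : q ∈ Q
    · simp only [hu, hq, if_true]
      exact Int.mul_ediv_cancel' (hp.row_dvd hh hq)
    · have := hp.mem_row
      simp only [hu, hq, if_false, mul_zero]
      exact (hh.zero a q (by tauto)).symm
  have hM : IsIwahoriOn Q (siegel b u) := by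
    refine siegel_mem hh.swap_col hp.mem_col (fun q hq => by simp [hu, hq]) fun q hlt => ?_
    by_cases hq : q ∈ Q
    · refine two_dvd_of_two_mul_dvd (hp.dvd a hp.mem_row b hp.mem_col) hp.not_dvd ?_
      rw [hxu]
      exact hp.row q hq hlt
    · simp [hu, hq]
  have hB := hM.adj_mem hh.swap_col
  have hrow : ∀ q, (h * SpIwahori.adj (siegel b u)) a q =
      h a b * (1 : Matrix (Fin m ⊕ Fin m) (Fin m ⊕ Fin m) ℤ) b q := by
    intro q
    rw [← hM.mul_adj, Matrix.mul_apply, Matrix.mul_apply, Finset.mul_sum]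
    refine Finset.sum_congr rfl fun k _ => ?_
    rw [siegel_row, ← mul_assoc]
    split_ifs with hk
    · rw [hk, mul_one]
    · rw [hxu]
  have hcol : ∀ p, (h * SpIwahori.adj (siegel b u)) p b = h p b := by
    intro p
    have h1 := mul_siegel_single_same (h * SpIwahori.adj (siegel b u)) u p b
    rw [Matrix.mul_assoc, hM.adj_mul_self, Matrix.mul_one] at h1
    exact h1.symm
  have hzero : ∀ q ≠ b, (h * SpIwahori.adj (siegel b u)) a q = 0 := fun q hq => by
    rw [hrow, Matrix.one_apply_ne hq.symm, mul_zero]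
  refine ⟨SpIwahori.adj (siegel b u), hB, ?_, hzero, hcol⟩
  have hpiv : IsPivot T P Q (h * SpIwahori.adj (siegel b u)) a b := by
    refine ⟨hp.mem_row, hp.mem_col, fun p hpP q _ => hh.dvd_mul_right hp.dvd _ hpP q, ?_,
      fun q _ hlt => ?_, fun p hpP hlt => ?_⟩
    · rw [hcol]; exact hp.not_dvd
    · rw [hzero q (by rintro rfl; exact lt_irrefl _ hlt)]
      exact dvd_zero _
    · rw [hcol]; exact hp.col p hpP hlt
  have h2 := hp.of_natAbs_eq (A := 1) (B := SpIwahori.adj (siegel b u)) .one hB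
  rw [Matrix.one_mul] at h2
  exact h2 hpiv (hcol a)

lemma exists_clear_col (hh : IsBlock P Q h μ) (hp : IsMinPivot T P Q h a b) :
    ∃ A, IsIwahoriOn P A ∧ IsMinPivot T P Q (A * h) a b ∧ (∀ p ≠ a, (A * h) p b = 0) ∧
      ∀ q, (A * h) a q = h a q := by
  obtain ⟨B, hB, h1, h2, h3⟩ := (hp.adj hh).exists_clear_row hh.adj
  have he : SpIwahori.adj B * h = SpIwahori.adj (SpIwahori.adj h * B) := by
    rw [adj_mul, adj_adj]
  refine ⟨SpIwahori.adj B, hB.adj_mem hh.swap_row, ?_, fun p hpa => ?_, fun q => ?_⟩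
  · simpa [he] using h1.adj (hh.adj.mul_right hB)
  · rw [he, adj_apply_eq_zero_iff]
    exact h2 _ fun e => hpa (by simpa using congrArg Sum.swap e)
  · rw [he, adj_apply, h3, ← adj_apply, adj_adj]

lemma dvd_block (hh : IsBlock P Q h μ) (hp : IsMinPivot T P Q h a b)
    (hcol : ∀ p ≠ a, h p b = 0) : ∀ p ∈ P, ∀ q ∈ Q, h a b ∣ h p q := by
  intro p hpP q hq
  by_cases hpa : p = a
  · rw [hpa]; exact hp.row_dvd hh hq
  obtain ⟨hE, hE2⟩ := siegel_single_mem hh.swap_row hp.mem_row hpP 1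
  have hrow : ∀ k, (siegel a (Pi.single p (2 * 1)) * h) a k = h a k + 2 * h p k := by
    intro k
    have : ∀ l, siegel a (Pi.single p (2 * 1)) a l =
        (Pi.single a 1 : Fin m ⊕ Fin m → ℤ) l + (Pi.single p 2 : Fin m ⊕ Fin m → ℤ) l := by
      intro l
      rw [siegel_row]
      by_cases hl : l = a
      · subst hl; simp [Ne.symm hpa]
      · simp [hl]
    rw [Matrix.mul_apply]
    simp only [this, add_mul, Finset.sum_add_distrib, Pi.single_apply, ite_mul, zero_mul, one_mul,
      Finset.sum_ite_eq', Finset.mem_univ, if_true]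
  have h2 := hp.of_natAbs_eq (B := 1) hE .one
  rw [Matrix.mul_one] at h2
  have h3 := h2 (hp.toIsPivot.mul_left hh hE2 hE) (by rw [hrow, hcol p hpa, mul_zero, add_zero])
  have h4 := h3.row_dvd (hh.mul_left hE) hq
  rw [hrow, hrow, hcol p hpa, mul_zero, add_zero, dvd_add_right (hp.row_dvd hh hq)] at h4
  obtain ⟨z, hz⟩ := h4
  obtain ⟨w, rfl⟩ : 2 ∣ z := by
    refine two_dvd_of_two_mul_dvd (hp.dvd a hp.mem_row b hp.mem_col) hp.not_dvd ?_
    rw [← hz]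
    exact mul_dvd_mul_left 2 (hp.dvd p hpP q hq)
  exact ⟨w, by linarith⟩

end IsMinPivot

lemma IsBlock.exists_isPivot (hh : IsBlock P Q h μ) (hμ : μ ≠ 0) (hP : P.Nonempty) :
    ∃ T a b, IsPivot T P Q h a b := by
  obtain ⟨r, hr⟩ := hP
  obtain ⟨k, hk⟩ : ∃ k, h r k ≠ 0 := by
    by_contra! hz
    have := congrFun (congrFun hh.mul_adj r) r
    rw [Matrix.mul_apply] at this
    simp [hz] at this
    exact hμ this.symm
  have hkQ : k ∈ Q := by
    by_contra hkQ
    exact hk (hh.zero r k (by tauto))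
  have hex : ∃ e : ℕ, ¬ ∀ p ∈ P, ∀ q ∈ Q, (2 : ℤ) ^ e ∣ h p q := by
    refine ⟨(h r k).natAbs, fun hd => ?_⟩
    have h1 := Int.natAbs_dvd_natAbs.2 (hd r hr k hkQ)
    rw [Int.natAbs_pow] at h1
    exact absurd (Nat.le_of_dvd (Int.natAbs_pos.2 hk) h1) (not_le.2 Nat.lt_two_pow_self)
  classical
  obtain ⟨e, he⟩ : ∃ e, Nat.find hex = e + 1 := by
    refine Nat.exists_eq_succ_of_ne_zero fun h0 => ?_
    have := Nat.find_spec hex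
    rw [h0] at this
    simp at this
  have hdvd : ∀ p ∈ P, ∀ q ∈ Q, (2 : ℤ) ^ e ∣ h p q := by
    by_contra hne
    exact Nat.find_min hex (m := e) (by omega) hne
  have hnd := Nat.find_spec hex
  rw [he, pow_succ'] at hnd
  push Not at hnd
  obtain ⟨p, hp, q, hq, hpq⟩ := hnd
  obtain ⟨a, ha, hamax⟩ := (P.filter fun p => ∃ q ∈ Q, ¬ 2 * (2 : ℤ) ^ e ∣ h p q).exists_max_image
    rk ⟨p, Finset.mem_filter.2 ⟨hp, q, hq, hpq⟩⟩
  obtain ⟨haP, q', hq', haq'⟩ := Finset.mem_filter.1 ha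
  obtain ⟨b, hb, hbmin⟩ := (Q.filter fun q => ¬ 2 * (2 : ℤ) ^ e ∣ h a q).exists_min_image
    rk ⟨q', Finset.mem_filter.2 ⟨hq', haq'⟩⟩
  obtain ⟨hbQ, hab⟩ := Finset.mem_filter.1 hb
  refine ⟨2 ^ e, a, b, haP, hbQ, hdvd, hab, fun q hq hlt => ?_, fun p hp hlt => ?_⟩
  · by_contra hn
    exact absurd (hbmin q (Finset.mem_filter.2 ⟨hq, hn⟩)) (not_le.2 hlt)
  · by_contra hn
    exact absurd (hamax p (Finset.mem_filter.2 ⟨hp, b, hbQ, hn⟩)) (not_le.2 hlt)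

lemma IsPivot.exists_isMinPivot (hp : IsPivot T P Q h a b) :
    ∃ A B, IsIwahoriOn P A ∧ IsIwahoriOn Q B ∧ IsMinPivot T P Q (A * h * B) a b := by
  classical
  have hex : ∃ n : ℕ, ∃ A B, IsIwahoriOn P A ∧ IsIwahoriOn Q B ∧
      IsPivot T P Q (A * h * B) a b ∧ ((A * h * B) a b).natAbs = n :=
    ⟨_, 1, 1, .one, .one, by simpa using hp, rfl⟩
  obtain ⟨A, B, hA, hB, hAB, he⟩ := Nat.find_spec hex
  refine ⟨A, B, hA, hB, hAB, fun A' B' hA' hB' hp' => ?_⟩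
  rw [he]
  have h1 : A' * (A * h * B) * B' = (A' * A) * h * (B * B') := by simp [Matrix.mul_assoc]
  rw [h1] at hp' ⊢
  exact Nat.find_min' hex ⟨_, _, hA'.mul hA, hB.mul hB', hp', rfl⟩

lemma IsBlock.exists_clear (hh : IsBlock P Q h μ) (hμ : μ ≠ 0) (hP : P.Nonempty) :
    ∃ A B a b, IsIwahoriOn P A ∧ IsIwahoriOn Q B ∧ a ∈ P ∧ b ∈ Q ∧ (A * h * B) a b ≠ 0 ∧
      (∀ q ≠ b, (A * h * B) a q = 0) ∧ (∀ p ≠ a, (A * h * B) p b = 0) ∧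
      ∀ p ∈ P, ∀ q ∈ Q, (A * h * B) a b ∣ (A * h * B) p q := by
  obtain ⟨T, a, b, hp⟩ := hh.exists_isPivot hμ hP
  obtain ⟨A, B, hA, hB, h1⟩ := hp.exists_isMinPivot
  have hh1 := (hh.mul_left hA).mul_right hB
  obtain ⟨B', hB', h2, hrow, -⟩ := h1.exists_clear_row hh1
  have hh2 := hh1.mul_right hB'
  obtain ⟨A', hA', h3, hcol, hrow'⟩ := h2.exists_clear_col hh2
  have he : A' * A * h * (B * B') = A' * (A * h * B * B') := by simp [Matrix.mul_assoc]
  refine ⟨A' * A, B * B', a, b, hA'.mul hA, hB.mul hB', hp.mem_row, hp.mem_col, ?_⟩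
  rw [he]
  exact ⟨h3.ne_zero, fun q hq => by rw [hrow', hrow q hq], hcol,
    h3.dvd_block (hh2.mul_left hA') hcol⟩

lemma IsBlock.mul_eq_of_row (hh : IsBlock P Q h μ) {r s : Fin m ⊕ Fin m}
    (hr : ∀ k ≠ s, h r k = 0) (p : Fin m ⊕ Fin m) :
    h p s.swap * h r s * (sgn s * sgn r) = if p = r.swap then μ else 0 := by
  have h1 := congrFun (congrFun hh.mul_adj p) r.swap
  rw [Matrix.mul_apply, Finset.sum_eq_single s.swap, adj_apply, Matrix.smul_apply,
    Matrix.one_apply, Sum.swap_swap, Sum.swap_swap, sgn_swap, sgn_swap] at h1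
  · simp only [smul_eq_mul, mul_ite, mul_one, mul_zero] at h1
    rw [← h1]
    ring
  · intro k _ hk
    rw [adj_apply, Sum.swap_swap, hr _ fun e => hk (swap_eq_iff.1 e)]
    simp
  · simp

lemma IsBlock.eq_zero_of_row (hh : IsBlock P Q h μ) {r s : Fin m ⊕ Fin m}
    (hr : ∀ k ≠ s, h r k = 0) (hrs : h r s ≠ 0) {p : Fin m ⊕ Fin m} (hp : p ≠ r.swap) :
    h p s.swap = 0 := by
  have h1 := hh.mul_eq_of_row hr p
  rw [if_neg hp] at h1
  have h2 : sgn s * sgn r ≠ 0 := ((isUnit_sgn s).mul (isUnit_sgn r)).ne_zero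
  simpa [hrs, h2] using h1

lemma IsBlock.swap_ne_zero_of_row (hh : IsBlock P Q h μ) (hμ : μ ≠ 0) {r s : Fin m ⊕ Fin m}
    (hr : ∀ k ≠ s, h r k = 0) : h r.swap s.swap ≠ 0 := by
  intro h0
  have h1 := hh.mul_eq_of_row hr r.swap
  rw [h0, if_pos rfl] at h1
  simp at h1
  exact hμ h1.symm

lemma IsBlock.eq_zero_of_col (hh : IsBlock P Q h μ) {r s : Fin m ⊕ Fin m}
    (hs : ∀ k ≠ r, h k s = 0) (hrs : h r s ≠ 0) {q : Fin m ⊕ Fin m} (hq : q ≠ s.swap) :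
    h r.swap q = 0 := by
  have := hh.adj.eq_zero_of_row (r := s.swap) (s := r.swap) (p := q.swap) (fun k hk => by
    rw [adj_apply_eq_zero_iff, Sum.swap_swap]
    exact hs _ fun e => hk (swap_eq_iff.1 e)) (by
    rw [Ne, adj_apply_eq_zero_iff]
    simpa using hrs) fun e => hq (by rw [← swap_eq_iff]; simpa using e)
  rw [adj_apply_eq_zero_iff] at this
  simpa using this

end Clear

/-- A symplectic similitude can be reduced to a monomial matrix by Iwahori matrices, in such a
way that any two entries are comparable with respect to divisibility. -/
theorem IsBlock.exists_monomial {μ : ℤ} (hμ : μ ≠ 0) (P : Finset (Fin m ⊕ Fin m)) :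
    ∀ (Q : Finset (Fin m ⊕ Fin m)) (h : Matrix (Fin m ⊕ Fin m) (Fin m ⊕ Fin m) ℤ),
      IsBlock P Q h μ → ∃ A B, IsIwahoriOn P A ∧ IsIwahoriOn Q B ∧
        (∀ p ∈ P, ∃ q, (A * h * B) p q ≠ 0 ∧ ∀ k ≠ q, (A * h * B) p k = 0) ∧
        ∀ p ∈ P, ∀ q ∈ Q, ∀ p' ∈ P, ∀ q' ∈ Q,
          (A * h * B) p q ∣ (A * h * B) p' q' ∨ (A * h * B) p' q' ∣ (A * h * B) p q := by
  induction P using Finset.strongInduction with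
  | H P ih =>
  intro Q h hh
  rcases P.eq_empty_or_nonempty with rfl | hP
  · exact ⟨1, 1, .one, .one, by simp, by simp⟩
  obtain ⟨A, B, a, b, hA, hB, ha, hb, hx, hrow, hcol, hdvd⟩ := hh.exists_clear hμ hP
  have hg := (hh.mul_left hA).mul_right hB
  set g := A * h * B with hgdef
  have ha' := hh.swap_row a ha
  have hb' := hh.swap_col b hb
  have hrow' : ∀ q ≠ b.swap, g a.swap q = 0 := fun q hq => hg.eq_zero_of_col hcol hx hq
  have hcol' : ∀ p ≠ a.swap, g p b.swap = 0 := fun p hp => hg.eq_zero_of_row hrow hx hp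
  have hx' : g a.swap b.swap ≠ 0 := hg.swap_ne_zero_of_row hμ hrow
  have hss : ∀ c p : Fin m ⊕ Fin m, (p.swap ≠ c ∧ p.swap ≠ c.swap) ↔ (p ≠ c ∧ p ≠ c.swap) := by
    intro c p
    simp only [ne_eq, swap_eq_iff, Sum.swap_swap]
    tauto
  have hgP : IsBlock (P.filter fun p => p ≠ a ∧ p ≠ a.swap)
      (Q.filter fun q => q ≠ b ∧ q ≠ b.swap) g μ := by
    refine ⟨fun p hp => ?_, fun q hq => ?_, fun p q hpq => ?_, hg.mul_adj, hg.adj_mul⟩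
    · rw [Finset.mem_filter] at *
      exact ⟨hh.swap_row p hp.1, (hss a p).2 hp.2⟩
    · rw [Finset.mem_filter] at *
      exact ⟨hh.swap_col q hq.1, (hss b q).2 hq.2⟩
    · by_cases h1 : p ∈ P ↔ q ∈ Q
      swap
      · exact hg.zero p q h1
      by_contra hne
      have c1 : p = a → q = b := fun e => by_contra fun hq => hne (e ▸ hrow q hq)
      have c2 : p = a.swap → q = b.swap := fun e => by_contra fun hq => hne (e ▸ hrow' q hq)
      have c3 : q = b → p = a := fun e => by_contra fun hp => hne (e ▸ hcol p hp)
      have c4 : q = b.swap → p = a.swap := fun e => by_contra fun hp => hne (e ▸ hcol' p hp)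
      simp only [Finset.mem_filter] at hpq
      tauto
  have hss' : (P.filter fun p => p ≠ a ∧ p ≠ a.swap) ⊂ P :=
    Finset.filter_ssubset.2 ⟨a, ha, by simp⟩
  obtain ⟨A', B', hA', hB', hmon, hcomp⟩ := ih _ hss' _ g hgP
  have he : A' * A * h * (B * B') = A' * g * B' := by simp [hgdef, Matrix.mul_assoc]
  have hA'P := hA'.mono (Finset.filter_subset _ P)
  have hB'Q := hB'.mono (Finset.filter_subset _ Q)
  refine ⟨A' * A, B * B', hA'P.mul hA, hB.mul hB'Q, ?_⟩
  rw [he]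
  have hf := (hgP.mul_left hA').mul_right hB'
  have hfdvd := hg.dvd_mul_mul hdvd hA'P B'
  have hout : ∀ p, p ∉ P.filter (fun p => p ≠ a ∧ p ≠ a.swap) → ∀ q,
      (A' * g * B') p q = g p q := by
    intro p hp q
    have h1 : ∀ k, (A' * g) p k = g p k := by
      intro k
      rw [Matrix.mul_apply]
      simp only [fun l => hA'.outside p l (Or.inl hp)]
      rw [← Matrix.mul_apply, Matrix.one_mul]
    rw [Matrix.mul_apply]
    simp only [h1]
    have h2 : ∀ k, g p k * B' k q = g p k * (1 : Matrix _ _ ℤ) k q := by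
      intro k
      by_cases hk : k ∈ Q.filter fun q => q ≠ b ∧ q ≠ b.swap
      · rw [hgP.zero p k (by tauto), zero_mul, zero_mul]
      · rw [hB'.outside k q (Or.inl hk)]
    simp only [h2]
    rw [← Matrix.mul_apply, Matrix.mul_one]
  have hfa : ∀ q, (A' * g * B') a q = g a q := hout a (by simp)
  have hfa' : ∀ q, (A' * g * B') a.swap q = g a.swap q := hout a.swap (by simp)
  have hzero := hf.zero
  clear_value g
  generalize A' * g * B' = f at *
  have hmul : f a.swap b.swap * f a b * (sgn b * sgn a) = μ := by
    rw [hf.mul_eq_of_row (fun k hk => by rw [hfa, hrow k hk]) a.swap, if_pos rfl]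
  constructor
  · intro p hp
    by_cases hpa : p = a
    · subst hpa
      exact ⟨b, by rwa [hfa], fun k hk => by rw [hfa, hrow k hk]⟩
    · by_cases hpa' : p = a.swap
      · subst hpa'
        exact ⟨b.swap, by rwa [hfa'], fun k hk => by rw [hfa', hrow' k hk]⟩
      · exact hmon p (Finset.mem_filter.2 ⟨hp, hpa, hpa'⟩)
  -- the last pivot is divisible by all other entries
  have hlast : ∀ p ∈ P.filter (fun p => p ≠ a ∧ p ≠ a.swap), ∀ q,
      f p q ∣ f a.swap b.swap ∨ f p q = 0 := by
    intro p hp q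
    obtain ⟨s, hs0, hs⟩ := hmon p hp
    by_cases hqs : q = s
    · subst hqs
      left
      have h1 := hf.mul_eq_of_row hs p.swap
      rw [if_pos rfl, ← hmul] at h1
      have hsQ : q.swap ∈ Q := by
        by_contra hq
        have hq' : q ∉ Q := fun h => hq (hh.swap_col _ h)
        refine hs0 (hzero p q ?_)
        simp only [Finset.mem_filter] at hp ⊢
        tauto
      obtain ⟨z, hz⟩ := hfdvd p.swap (hh.swap_row _ (Finset.mem_filter.1 hp).1) q.swap hsQ
      rw [hz, ← hfa] at h1
      have hab : f a b ≠ 0 := by rwa [hfa]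
      have h2 : z * f p q * (sgn q * sgn p) = f a.swap b.swap * (sgn b * sgn a) := by
        apply mul_left_cancel₀ hab
        linear_combination h1
      rw [← ((isUnit_sgn b).mul (isUnit_sgn a)).dvd_mul_right, ← h2]
      exact Dvd.intro (z * (sgn q * sgn p)) (by ring)
    · exact Or.inr (hs q hqs)
  have key : ∀ p ∈ P, ∀ q ∈ Q, ∀ p' ∈ P, ∀ q' ∈ Q,
      (p' = a ∨ p' = a.swap) → f p q ∣ f p' q' ∨ f p' q' ∣ f p q := by
    intro p hp q hq p' hp' q' hq' hor
    rcases hor with rfl | rfl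
    · by_cases hqb : q' = b
      · subst hqb
        rw [hfa]
        exact Or.inr (hfdvd p hp q hq)
      · rw [hfa, hrow _ hqb]
        exact Or.inl (dvd_zero _)
    · by_cases hqb : q' = b.swap
      swap
      · rw [hfa', hrow' _ hqb]
        exact Or.inl (dvd_zero _)
      subst hqb
      by_cases hpa : p = a
      · subst hpa
        by_cases hqb : q = b
        · subst hqb
          rw [hfa]
          exact Or.inl (hfdvd _ hp' _ hq')
        · rw [hfa, hrow _ hqb]
          exact Or.inr (dvd_zero _)
      by_cases hpa' : p = a.swap
      · subst hpa'
        by_cases hqb : q = b.swap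
        · rw [hqb]; exact Or.inl dvd_rfl
        · rw [hfa' q, hrow' _ hqb]
          exact Or.inr (dvd_zero _)
      · rcases hlast p (Finset.mem_filter.2 ⟨hp, hpa, hpa'⟩) q with h1 | h1
        · exact Or.inl h1
        · rw [h1]
          exact Or.inr (dvd_zero _)
  intro p hp q hq p' hp' q' hq'
  by_cases h1 : p' = a ∨ p' = a.swap
  · exact key p hp q hq p' hp' q' hq' h1
  by_cases h2 : p = a ∨ p = a.swap
  · exact (key p' hp' q' hq' p hp q hq h2).symm
  rw [not_or] at h1 h2
  have hz : ∀ p ∈ P, (p ≠ a ∧ p ≠ a.swap) → ∀ q ∈ Q,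
      q ∈ Q.filter (fun q => q ≠ b ∧ q ≠ b.swap) ∨ f p q = 0 := by
    intro p hp hpa q hq
    by_cases h3 : q ∈ Q.filter (fun q => q ≠ b ∧ q ≠ b.swap)
    · exact Or.inl h3
    · refine Or.inr (hzero p q fun hiff => h3 (hiff.1 (Finset.mem_filter.2 ⟨hp, hpa⟩)))
  rcases hz p hp h2 q hq with h3 | h3
  · rcases hz p' hp' h1 q' hq' with h4 | h4
    · exact hcomp p (Finset.mem_filter.2 ⟨hp, h2⟩) q h3 p' (Finset.mem_filter.2 ⟨hp', h1⟩) q' h4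
    · rw [h4]; exact Or.inl (dvd_zero _)
  · rw [h3]; exact Or.inr (dvd_zero _)

section BaseChange

variable {R S : Type*} [CommRing R] [CommRing S]

lemma Jmat_map (f : R →+* S) : (Jmat m R).map f = Jmat m S := by
  ext (i | i) (j | j) <;> simp [Jmat, Matrix.one_apply, apply_ite f]

lemma adj_map (f : R →+* S) (A : Matrix (Fin m ⊕ Fin m) (Fin m ⊕ Fin m) R) :
    adj (A.map f) = (adj A).map f := by
  rw [adj, adj, ← Jmat_map f, ← Matrix.transpose_map, ← Matrix.map_mul, ← Matrix.map_mul]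
  ext
  exact (map_neg f _).symm

lemma SpSet_map (f : R →+* S) {A : Matrix (Fin m ⊕ Fin m) (Fin m ⊕ Fin m) R}
    (hA : A ∈ SpSet m R) : A.map f ∈ SpSet m S := by
  rw [mem_SpSet_iff] at *
  rw [adj_map, ← Matrix.map_mul, hA]
  simp

end BaseChange

lemma castQ_eq_map (A : Matrix (Fin m ⊕ Fin m) (Fin m ⊕ Fin m) ℤ) :
    castQ m A = A.map (Int.castRingHom ℚ) := rfl

lemma castQ_mul (A B : Matrix (Fin m ⊕ Fin m) (Fin m ⊕ Fin m) ℤ) :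
    castQ m (A * B) = castQ m A * castQ m B := by
  simp only [castQ_eq_map, Matrix.map_mul]

lemma castQ_injective : Function.Injective (castQ m) :=
  Matrix.map_injective Int.cast_injective

lemma castQ_smul_one (μ : ℤ) :
    castQ m (μ • (1 : Matrix (Fin m ⊕ Fin m) (Fin m ⊕ Fin m) ℤ)) = (μ : ℚ) • 1 := by
  ext p q
  simp only [castQ, Matrix.map_apply, Matrix.smul_apply, Matrix.one_apply]
  split_ifs <;> simp

lemma castQ_mem_SpSet {A : Matrix (Fin m ⊕ Fin m) (Fin m ⊕ Fin m) ℤ} (hA : A ∈ SpSet m ℤ) :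
    castQ m A ∈ SpSet m ℚ :=
  SpSet_map (Int.castRingHom ℚ) hA

lemma IsIwahoriOn.mem_IwahoriSet {Q : Finset (Fin m ⊕ Fin m)}
    {A : Matrix (Fin m ⊕ Fin m) (Fin m ⊕ Fin m) ℤ} (hA : IsIwahoriOn Q A) :
    A ∈ IwahoriSet m := by
  have hSp := (mem_SpSet_iff A).2 hA.mul_adj
  refine ⟨hSp, ?_⟩
  have hmod : A.map (Int.cast : ℤ → ZMod 2) * Jmat m (ZMod 2) *
      (A.map (Int.cast : ℤ → ZMod 2))ᵀ = Jmat m (ZMod 2) :=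
    SpSet_map (Int.castRingHom (ZMod 2)) hSp
  have hlow : ∀ p q, rk q < rk p → A.map (Int.cast : ℤ → ZMod 2) p q = 0 := fun p q hlt =>
    (ZMod.intCast_zmod_eq_zero_iff_dvd _ 2).2 (hA.lower p q hlt)
  have hdiag : ∀ p, A.map (Int.cast : ℤ → ZMod 2) p p = 1 := by
    intro p
    have h1 : A.map (Int.cast : ℤ → ZMod 2) p p ≠ 0 := fun h0 =>
      hA.diag p ((ZMod.intCast_zmod_eq_zero_iff_dvd _ 2).1 h0)
    generalize A.map (Int.cast : ℤ → ZMod 2) p p = z at h1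
    revert z
    decide
  generalize A.map (Int.cast : ℤ → ZMod 2) = M at *
  obtain ⟨α, γ, ε, δ, rfl⟩ : ∃ α γ ε δ, M = Matrix.fromBlocks α γ ε δ :=
    ⟨_, _, _, _, (Matrix.fromBlocks_toBlocks M).symm⟩
  have hε : ε = 0 := by
    ext i j
    refine hlow (Sum.inr i) (Sum.inl j) ?_
    have := i.2
    have := j.2
    simp only [rk, Sum.elim_inl, Sum.elim_inr]
    omega
  subst hε
  simp only [Jmat, Matrix.fromBlocks_transpose, Matrix.fromBlocks_multiply,
    Matrix.fromBlocks_inj] at hmod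
  simp at hmod
  obtain ⟨h11, h12, -⟩ := hmod
  have h3 : δᵀ * α = 1 := mul_eq_one_comm.mp h12
  have h4 : αᵀ * δ = 1 := by simpa using congrArg Matrix.transpose h3
  have h5 : α * γᵀ = γ * αᵀ := by
    rw [← sub_eq_zero, ← h11]
    abel
  refine ⟨α, δᵀ * γ, fun i j hij => ?_, fun i => hdiag (Sum.inl i), ?_, ?_⟩
  · refine hlow (Sum.inl i) (Sum.inl j) ?_
    simp only [rk, Sum.elim_inl]
    have : (j : ℕ) < i := hij
    omega
  · calc (δᵀ * γ)ᵀ = (δᵀ * α) * γᵀ * δ := by simp [h3]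
      _ = δᵀ * γ * (αᵀ * δ) := by
        rw [Matrix.mul_assoc δᵀ, h5]
        simp only [Matrix.mul_assoc]
      _ = δᵀ * γ := by rw [h4, Matrix.mul_one]
  · rw [← Matrix.mul_assoc, h12, Matrix.one_mul, Matrix.inv_eq_right_inv h4]

lemma NSet_subset {n : Matrix (Fin m ⊕ Fin m) (Fin m ⊕ Fin m) ℤ} (hn : n ∈ NSet m) :
    n ∈ SpSet m ℤ := by
  obtain ⟨α, β, htri, hone, hβ, rfl⟩ := hn
  have hdet : αᵀ.det = 1 := by
    rw [Matrix.det_transpose, Matrix.det_of_isUpperTriangular fun i j hij => htri i j hij]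
    simp [hone]
  have h1 : αᵀ * (αᵀ)⁻¹ = 1 := Matrix.mul_nonsing_inv _ (by simp [hdet])
  have h2 : (αᵀ)⁻¹ * αᵀ = 1 := Matrix.nonsing_inv_mul _ (by simp [hdet])
  generalize (αᵀ)⁻¹ = δ at *
  have h3 : α * δᵀ = 1 := by simpa using congrArg Matrix.transpose h2
  change _ * _ * _ = _
  simp [Jmat, Matrix.fromBlocks_transpose, Matrix.fromBlocks_multiply, h2, h3, hβ,
    Matrix.mul_assoc]

lemma D0Set_subset {d : Matrix (Fin m ⊕ Fin m) (Fin m ⊕ Fin m) ℚ} (hd : d ∈ D0Set m) :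
    d ∈ SpSet m ℚ := by
  obtain ⟨d, hpos, -, rfl⟩ := hd
  have h : ∀ i, (d i : ℚ) ≠ 0 := fun i => by exact_mod_cast (hpos i).ne'
  change _ * _ * _ = _
  rw [← Matrix.fromBlocks_diagonal]
  simp [-Matrix.fromBlocks_diagonal, Jmat, Matrix.fromBlocks_transpose,
    Matrix.fromBlocks_multiply, h]
  rw [← Matrix.diagonal_one, Matrix.diagonal_neg]

section Weyl

variable {R : Type*} [CommRing R]

lemma permWeyl_mem (s : Equiv.Perm (Fin m)) : permWeyl m R s ∈ SpSet m R := by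
  set σ : Matrix (Fin m) (Fin m) R := Matrix.of fun i j => if s i = j then 1 else 0 with hσ
  have h1 : permWeyl m R s = Matrix.fromBlocks σ 0 0 σ := by
    ext (i | i) (j | j) <;> simp [permWeyl, hσ]
  have h2 : σ * σᵀ = 1 := by
    ext i j
    simp [Matrix.mul_apply, hσ, Matrix.one_apply]
  change _ * _ * _ = _
  rw [h1]
  simp [Jmat, Matrix.fromBlocks_transpose, Matrix.fromBlocks_multiply, h2]

lemma signWeyl_mem (S : Finset (Fin m)) : signWeyl m R S ∈ SpSet m R := by
  set c : Fin m → R := fun i => if i ∈ S then 0 else 1 with hc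
  set e : Fin m → R := fun i => if i ∈ S then 1 else 0 with he
  have h1 : signWeyl m R S = Matrix.fromBlocks (Matrix.diagonal c) (-Matrix.diagonal e)
      (Matrix.diagonal e) (Matrix.diagonal c) := by
    ext (i | i) (j | j) <;> by_cases hi : i ∈ S <;> by_cases hij : i = j <;>
      simp [signWeyl, hc, he, hi, hij] <;> simp_all
  have h2 : ∀ i, e i * e i + c i * c i = 1 := by
    intro i
    by_cases hi : i ∈ S <;> simp [hc, he, hi]
  have h3 : ∀ i, -(c i * c i) + -(e i * e i) = -1 := fun i => by linear_combination -h2 i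
  change _ * _ * _ = _
  rw [h1]
  simp only [Jmat, Matrix.fromBlocks_transpose, Matrix.fromBlocks_multiply, Matrix.mul_zero,
    Matrix.mul_one, Matrix.mul_neg, Matrix.diagonal_transpose,
    Matrix.diagonal_mul_diagonal, zero_add, add_zero, neg_neg,
    Matrix.diagonal_add, Matrix.diagonal_neg, h2]
  congr 1 <;> ext i j <;> by_cases hij : i = j <;> simp [hij, mul_comm, h3]

lemma WeylSet_subset {w : Matrix (Fin m ⊕ Fin m) (Fin m ⊕ Fin m) R} (hw : w ∈ WeylSet m R) :
    w ∈ SpSet m R := by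
  obtain ⟨s, S, rfl⟩ := hw
  exact SpSet_mul (permWeyl_mem s) (signWeyl_mem S)

lemma permWeyl_mul_apply (s : Equiv.Perm (Fin m))
    (A : Matrix (Fin m ⊕ Fin m) (Fin m ⊕ Fin m) R) (p q : Fin m ⊕ Fin m) :
    (permWeyl m R s * A) p q = A (Sum.map s s p) q := by
  rcases p with i | i <;> simp [Matrix.mul_apply, permWeyl]

end Weyl

lemma DSet_subset {d : Matrix (Fin m ⊕ Fin m) (Fin m ⊕ Fin m) ℚ} (hd : d ∈ DSet m) :
    d ∈ SpSet m ℚ := by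
  obtain ⟨d, hd, w, hw, rfl⟩ := hd
  have hw := WeylSet_subset hw
  exact SpSet_mul (SpSet_mul (SpSet_inv hw) (D0Set_subset hd)) hw

lemma diagonal_mem_DSet {δ : Fin m ⊕ Fin m → ℚ} {k : Fin m → ℤ} (hk : ∀ i, 0 < k i)
    (hcomp : ∀ i j, k i ∣ k j ∨ k j ∣ k i) (S : Finset (Fin m))
    (hin : ∀ i ∈ S, δ (Sum.inl i) = (k i : ℚ)⁻¹ ∧ δ (Sum.inr i) = k i)
    (hout : ∀ i ∉ S, δ (Sum.inl i) = k i ∧ δ (Sum.inr i) = (k i : ℚ)⁻¹) :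
    Matrix.diagonal δ ∈ DSet m := by
  set t : Equiv.Perm (Fin m) := Tuple.sort fun i => -k i with ht
  have hanti : ∀ i j, i ≤ j → k (t j) ≤ k (t i) := fun i j hij => by
    have := Tuple.monotone_sort (fun i => -k i) hij
    simpa using this
  have hw : permWeyl m ℚ t * signWeyl m ℚ S ∈ WeylSet m ℚ := ⟨t, S, rfl⟩
  refine ⟨_, ⟨fun i => k (t i), fun i => hk _, fun i j hij => ?_, rfl⟩, _, hw, ?_⟩
  · rcases hcomp (t j) (t i) with h | h
    · exact h
    · change k (t j) ∣ k (t i)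
      rw [le_antisymm (hanti i j hij) (Int.le_of_dvd (hk _) h)]
  · have hinv := mul_eq_one_comm.mp ((mem_SpSet_iff _).1 (WeylSet_subset hw))
    have hrow : ∀ p q, (permWeyl m ℚ t * signWeyl m ℚ S) p q =
        signWeyl m ℚ S (Sum.map t t p) q := permWeyl_mul_apply t _
    rw [Matrix.inv_eq_left_inv hinv, Matrix.mul_assoc]
    generalize permWeyl m ℚ t * signWeyl m ℚ S = w at *
    have : Matrix.diagonal (Sum.elim (fun i => (k (t i) : ℚ)) fun i => ((k (t i) : ℚ))⁻¹) * w =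
        w * Matrix.diagonal δ := by
      ext p q
      rw [Matrix.diagonal_mul, Matrix.mul_diagonal, hrow]
      rcases p with i | i <;> rcases q with j | j <;> by_cases hij : t i = j <;>
        by_cases hi : j ∈ S <;> simp [signWeyl, hij, hi, hin, hout]
    rw [this, ← Matrix.mul_assoc, hinv, Matrix.one_mul]

/-- A permutation of the basis vectors up to sign which commutes with the involution is given by
a Weyl element. -/
lemma exists_weyl {σ : Fin m ⊕ Fin m → Fin m ⊕ Fin m} (hσ : Function.Injective σ)
    (hswap : ∀ p, σ p.swap = (σ p).swap) :
    ∃ w ∈ WeylSet m ℚ, ∃ ε : Fin m ⊕ Fin m → ℤ, (∀ p, ε p * ε p = 1) ∧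
      (∀ p, ε p.swap * ε p = sgn (σ p) * sgn p) ∧
      ∀ p q, w p q = if q = σ p then (ε p : ℚ) else 0 := by
  set f : Fin m → Fin m := fun i => Sum.elim id id (σ (Sum.inl i)) with hf
  have hcase : ∀ i, (σ (Sum.inl i) = Sum.inl (f i) ∧ σ (Sum.inr i) = Sum.inr (f i)) ∨
      (σ (Sum.inl i) = Sum.inr (f i) ∧ σ (Sum.inr i) = Sum.inl (f i)) := by
    intro i
    have h1 : σ (Sum.inr i) = (σ (Sum.inl i)).swap := hswap (Sum.inl i)
    rw [h1]
    simp only [hf]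
    cases σ (Sum.inl i) <;> simp
  have hinj : Function.Injective f := by
    intro i j hij
    rcases hcase i with ⟨h1, h2⟩ | ⟨h1, h2⟩ <;> rcases hcase j with ⟨h3, h4⟩ | ⟨h3, h4⟩ <;>
      rw [hij] at h1 h2
    · exact Sum.inl_injective (hσ (h1.trans h3.symm))
    · exact absurd (hσ (h1.trans h4.symm)) (by simp)
    · exact absurd (hσ (h2.trans h3.symm)) (by simp)
    · exact Sum.inl_injective (hσ (h1.trans h3.symm))
  set s : Equiv.Perm (Fin m) := Equiv.ofBijective f (Finite.injective_iff_bijective.1 hinj)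
  have hs : ∀ i, s i = f i := fun i => rfl
  set S : Finset (Fin m) := Finset.univ.filter fun j => σ (Sum.inl (s.symm j)) = Sum.inr j
  have hS : ∀ i, f i ∈ S ↔ σ (Sum.inl i) = Sum.inr (f i) := by
    intro i
    rw [Finset.mem_filter, ← hs, Equiv.symm_apply_apply]
    simp
  refine ⟨permWeyl m ℚ s * signWeyl m ℚ S, ⟨s, S, rfl⟩,
    Sum.elim (fun i => sgn (σ (Sum.inl i))) fun _ => 1, ?_, ?_, ?_⟩
  · rintro (i | i) <;> simp [sgn_mul_self]
  · rintro (i | i)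
    · simp [sgn]
    · have h1 : σ (Sum.inr i) = (σ (Sum.inl i)).swap := hswap (Sum.inl i)
      rw [h1, sgn_swap]
      simp [sgn]
  · intro p q
    rw [permWeyl_mul_apply]
    rcases p with i | i <;> rcases hcase i with ⟨h1, h2⟩ | ⟨h1, h2⟩ <;> have h3 := hS i <;>
      rcases q with j | j <;> simp [h1, h2] at h3 ⊢ <;>
      simp [signWeyl, hs, h3, sgn, eq_comm]

lemma adj_smul {R : Type*} [CommRing R] (c : R) (A : Matrix (Fin m ⊕ Fin m) (Fin m ⊕ Fin m) R) :
    adj (c • A) = c • adj A := by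
  simp [adj, Matrix.transpose_smul]

lemma exists_castQ_eq_smul (g : Matrix (Fin m ⊕ Fin m) (Fin m ⊕ Fin m) ℚ) :
    ∃ N : ℤ, 0 < N ∧ ∃ h, castQ m h = (N : ℚ) • g := by
  obtain ⟨b, hb⟩ := IsLocalization.exist_integer_multiples_of_finite (nonZeroDivisors ℤ)
    fun x : (Fin m ⊕ Fin m) × (Fin m ⊕ Fin m) => g x.1 x.2
  choose f hf using hb
  have hb0 : (b : ℤ) ≠ 0 := nonZeroDivisors.ne_zero b.2
  refine ⟨b * b, mul_self_pos.2 hb0, Matrix.of fun p q => b * f (p, q), ?_⟩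
  ext p q
  have h1 : (f (p, q) : ℚ) = (b : ℤ) * g p q := by
    have := hf (p, q)
    rw [Algebra.smul_def] at this
    simpa using this
  simp [castQ, h1, mul_assoc]

lemma isBlock_of_castQ_eq_smul {g : Matrix (Fin m ⊕ Fin m) (Fin m ⊕ Fin m) ℚ}
    (hg : g ∈ SpSet m ℚ) {h : Matrix (Fin m ⊕ Fin m) (Fin m ⊕ Fin m) ℤ} {N : ℤ}
    (hN : castQ m h = (N : ℚ) • g) : IsBlock Finset.univ Finset.univ h (N ^ 2) := by
  rw [mem_SpSet_iff] at hg
  have hadj : castQ m (adj h) = (N : ℚ) • adj g := by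
    rw [← adj_smul, ← hN, castQ_eq_map, castQ_eq_map, adj_map]
  refine ⟨by simp, by simp, by simp, castQ_injective ?_, castQ_injective ?_⟩
  · rw [castQ_mul, hadj, hN, castQ_smul_one, Matrix.smul_mul, Matrix.mul_smul, hg, smul_smul]
    push_cast
    rw [sq]
  · rw [castQ_mul, hadj, hN, castQ_smul_one, Matrix.smul_mul, Matrix.mul_smul,
      mul_eq_one_comm.mp hg, smul_smul]
    push_cast
    rw [sq]

lemma dvd_of_mul_eq_sq {a b N : ℤ} (hN : 0 < N) (hab : a * b = N ^ 2) (h : a ∣ b) : N ∣ b := by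
  have h1 : a ^ 2 ∣ N ^ 2 := by
    rw [← hab, sq]
    exact mul_dvd_mul_left a h
  obtain ⟨c, rfl⟩ := (Int.pow_dvd_pow_iff two_ne_zero).1 h1
  have ha : a ≠ 0 := by rintro rfl; simp at hN
  have hb : b = a * c * c := mul_left_cancel₀ ha (by rw [hab]; ring)
  exact ⟨c, hb⟩

lemma isIwahoriOn_diagonal {ε : Fin m ⊕ Fin m → ℤ} (hε : ∀ p, ε p * ε p.swap = 1) :
    IsIwahoriOn Finset.univ (Matrix.diagonal ε) where
  mul_adj := by
    have h1 : adj (Matrix.diagonal ε) = Matrix.diagonal fun p => ε p.swap := by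
      ext p q
      rw [adj_apply]
      by_cases hpq : p = q
      · subst hpq
        simp [sgn_mul_self]
      · rw [Matrix.diagonal_apply_ne _ hpq, Matrix.diagonal_apply_ne, mul_zero]
        exact fun e => hpq (by simpa using congrArg Sum.swap e.symm)
    rw [h1, Matrix.diagonal_mul_diagonal]
    simp [hε]
  lower p q h := by
    rw [Matrix.diagonal_apply_ne]
    · simp
    · rintro rfl; exact lt_irrefl _ h
  diag p := by
    rw [Matrix.diagonal_apply_eq]
    intro h
    have := h.mul_right (ε p.swap)
    rw [hε] at this
    omega
  outside p q h := by simp at h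

lemma diagonal_div_mem_DSet {c : Fin m ⊕ Fin m → ℤ} {N : ℤ} (hN : 0 < N) (hc : ∀ p, 0 < c p)
    (hswap : ∀ p, c p.swap * c p = N ^ 2) (hcomp : ∀ p q, c p ∣ c q ∨ c q ∣ c p) :
    Matrix.diagonal (fun p => (c p : ℚ) / N) ∈ DSet m := by
  set S : Finset (Fin m) := Finset.univ.filter fun i => ¬ N ∣ c (Sum.inl i) with hS
  set r : Fin m → Fin m ⊕ Fin m := fun i => if i ∈ S then Sum.inr i else Sum.inl i with hr
  have hdvd : ∀ i, N ∣ c (r i) := by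
    intro i
    by_cases hi : N ∣ c (Sum.inl i)
    · simp [hr, hS, hi]
    · have h1 := hswap (Sum.inl i)
      rw [Sum.swap_inl] at h1
      have h2 : N ∣ c (Sum.inr i) := by
        rcases hcomp (Sum.inl i) (Sum.inr i) with h | h
        · exact dvd_of_mul_eq_sq hN (by rw [mul_comm, h1]) h
        · exact absurd (dvd_of_mul_eq_sq hN h1 h) hi
      simpa [hr, hS, hi] using h2
  choose k hk using hdvd
  have hkpos : ∀ i, 0 < k i := fun i => pos_of_mul_pos_right (hk i ▸ hc (r i)) hN.le
  have hNQ : (N : ℚ) ≠ 0 := by exact_mod_cast hN.ne'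
  have h1 : ∀ i, (c (r i) : ℚ) / N = k i := by
    intro i
    rw [hk, Int.cast_mul, mul_div_cancel_left₀ _ hNQ]
  have h2 : ∀ i, (c (r i).swap : ℚ) / N = (k i : ℚ)⁻¹ := by
    intro i
    have hki : (k i : ℚ) ≠ 0 := by exact_mod_cast (hkpos i).ne'
    have h3 : ((c (r i).swap * c (r i) : ℤ) : ℚ) = ((N ^ 2 : ℤ) : ℚ) := by rw [hswap]
    rw [hk i] at h3
    push_cast at h3
    field_simp
    apply mul_left_cancel₀ hNQ
    linear_combination h3
  refine diagonal_mem_DSet hkpos (fun i j => ?_) S (fun i hi => ?_) fun i hi => ?_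
  · have := hcomp (r i) (r j)
    rwa [hk, hk, mul_dvd_mul_iff_left hN.ne', mul_dvd_mul_iff_left hN.ne'] at this
  · have h3 := h1 i
    have h4 := h2 i
    simp only [hr, hi, if_true, Sum.swap_inr] at h3 h4
    exact ⟨h4, h3⟩
  · have h3 := h1 i
    have h4 := h2 i
    simp only [hr, hi, if_false, Sum.swap_inl] at h3 h4
    exact ⟨h3, h4⟩

lemma exists_factor_of_monomial {h : Matrix (Fin m ⊕ Fin m) (Fin m ⊕ Fin m) ℤ} {N : ℤ}
    (hN : 0 < N) (hh : IsBlock Finset.univ Finset.univ h (N ^ 2))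
    (hmono : ∀ p, ∃ q, h p q ≠ 0 ∧ ∀ k ≠ q, h p k = 0)
    (hcomp : ∀ p q p' q', h p q ∣ h p' q' ∨ h p' q' ∣ h p q) :
    ∃ E, IsIwahoriOn Finset.univ E ∧ ∃ d ∈ DSet m, ∃ w ∈ WeylSet m ℚ,
      castQ m h = (N : ℚ) • (castQ m E * d * w) := by
  choose σ hne hzero using hmono
  have huniq : ∀ p q, h p q ≠ 0 → q = σ p := fun p q hpq =>
    not_not.1 fun hq => hpq (hzero p q hq)
  have hN2 : N ^ 2 ≠ 0 := pow_ne_zero 2 hN.ne'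
  have hswap : ∀ p, σ p.swap = (σ p).swap := fun p =>
    (huniq _ _ (hh.swap_ne_zero_of_row hN2 (hzero p))).symm
  have hinj : Function.Injective σ := by
    intro p q hpq
    by_contra hne'
    refine hne q.swap ?_
    rw [hswap, ← hpq]
    exact hh.eq_zero_of_row (hzero p) (hne p) fun e => hne' (by
      simpa using (congrArg Sum.swap e).symm)
  obtain ⟨w, hw, ε, hεε, hεs, hwε⟩ := exists_weyl hinj hswap
  set Λ : Fin m ⊕ Fin m → ℤ := fun p => h p (σ p) * ε p with hΛ
  have hΛs : ∀ p, Λ p.swap * Λ p = N ^ 2 := by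
    intro p
    have h1 := hh.mul_eq_of_row (hzero p) p.swap
    rw [if_pos rfl, ← hswap] at h1
    simp only [hΛ]
    linear_combination h1 + h p.swap (σ p.swap) * h p (σ p) * hεs p
  have hΛ0 : ∀ p, Λ p ≠ 0 := fun p h0 => hN2 (by rw [← hΛs p, h0, mul_zero])
  have habs : ∀ p, |Λ p| = |h p (σ p)| := by
    intro p
    have h1 : |ε p| = 1 := by
      rcases mul_self_eq_one_iff.1 (hεε p) with h | h <;> simp [h]
    simp [hΛ, abs_mul, h1]
  refine ⟨Matrix.diagonal fun p => (Λ p).sign, isIwahoriOn_diagonal fun p => ?_,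
    Matrix.diagonal fun p => ((|Λ p| : ℤ) : ℚ) / N,
    diagonal_div_mem_DSet hN (fun p => abs_pos.2 (hΛ0 p)) (fun p => ?_) (fun p q => ?_),
    w, hw, ?_⟩
  · rw [← Int.sign_mul, mul_comm, hΛs]
    exact Int.sign_eq_one_of_pos (pow_pos hN 2)
  · rw [← abs_mul, hΛs]
    exact abs_of_pos (pow_pos hN 2)
  · rw [habs, habs, abs_dvd_abs, abs_dvd_abs]
    exact hcomp _ _ _ _
  · have hE : castQ m (Matrix.diagonal fun p => (Λ p).sign) =
        Matrix.diagonal fun p => ((Λ p).sign : ℚ) := by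
      rw [castQ, Matrix.diagonal_map (by simp)]
    have hNQ : (N : ℚ) ≠ 0 := by exact_mod_cast hN.ne'
    ext p q
    rw [hE, Matrix.diagonal_mul_diagonal, Matrix.smul_apply, Matrix.diagonal_mul, hwε, castQ,
      Matrix.map_apply]
    by_cases hq : q = σ p
    · subst hq
      have h1 : h p (σ p) = (Λ p).sign * |Λ p| * ε p := by
        rw [Int.sign_mul_abs]
        simp only [hΛ]
        linear_combination -(h p (σ p)) * hεε p
      rw [h1, if_pos rfl, smul_eq_mul]
      push_cast
      field_simp
    · rw [hzero p q hq]
      simp [hq]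

end SpIwahori

/-- For `ω ∈ 𝔚`, `n ∈ N` and `d ∈ D` one has `ω n d ∈ I d' ω' I` for some
`d' ∈ D` and `ω' ∈ 𝔚`. -/
theorem stmt_2 (m : ℕ) (hm : 1 ≤ m)
    (w : Matrix (Fin m ⊕ Fin m) (Fin m ⊕ Fin m) ℚ) (hw : w ∈ WeylSet m ℚ)
    (n : Matrix (Fin m ⊕ Fin m) (Fin m ⊕ Fin m) ℤ) (hn : n ∈ NSet m)
    (d : Matrix (Fin m ⊕ Fin m) (Fin m ⊕ Fin m) ℚ) (hd : d ∈ DSet m) :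
    ∃ d' ∈ DSet m, ∃ w' ∈ WeylSet m ℚ, ∃ i₁ ∈ IwahoriSet m, ∃ i₂ ∈ IwahoriSet m,
      w * castQ m n * d = castQ m i₁ * d' * w' * castQ m i₂ := by
  open SpIwahori in
  have hg : w * castQ m n * d ∈ SpSet m ℚ :=
    SpSet_mul (SpSet_mul (WeylSet_subset hw) (castQ_mem_SpSet (NSet_subset hn))) (DSet_subset hd)
  obtain ⟨N, hN, h, hNg⟩ := exists_castQ_eq_smul (w * castQ m n * d)
  have hh := isBlock_of_castQ_eq_smul hg hNg
  obtain ⟨A, B, hA, hB, hmono, hcomp⟩ :=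
    IsBlock.exists_monomial (pow_ne_zero 2 hN.ne') Finset.univ Finset.univ h hh
  obtain ⟨E, hE, d', hd', w', hw', hAhB⟩ := exists_factor_of_monomial hN
    ((hh.mul_left hA).mul_right hB) (fun p => hmono p (Finset.mem_univ p)) fun p q p' q' =>
      hcomp p (Finset.mem_univ p) q (Finset.mem_univ q) p' (Finset.mem_univ p') q'
        (Finset.mem_univ q')
  have hswap : ∀ q ∈ (Finset.univ : Finset (Fin m ⊕ Fin m)), q.swap ∈ Finset.univ := by simp
  refine ⟨d', hd', w', hw', adj A * E, ((hA.adj_mem hswap).mul hE).mem_IwahoriSet,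
    adj B, (hB.adj_mem hswap).mem_IwahoriSet, ?_⟩
  have hNQ : (N : ℚ) ≠ 0 := by exact_mod_cast hN.ne'
  have h1 : h = adj A * (A * h * B) * adj B := by
    calc h = (adj A * A) * h * (B * adj B) := by simp [hA.adj_mul_self, hB.mul_adj]
      _ = adj A * (A * h * B) * adj B := by simp only [Matrix.mul_assoc]
  apply smul_right_injective _ hNQ
  beta_reduce
  rw [← hNg, h1, castQ_mul, castQ_mul, hAhB, castQ_mul]
  simp only [Matrix.mul_smul, Matrix.smul_mul, Matrix.mul_assoc]
end

section
/- Let t be a positive integer. If t is even then ω d_t n₁ ω ∈ I d_t⁻¹ I, and if t is odd then ω d_t n₁ ω ∈ I ω d_t⁻¹ I. -/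
/-- The Iwahori subgroup of `SL₂(ℤ)` at the prime 2: integral matrices of
determinant one whose lower-left entry is even. -/
def Iw2 : Set (Matrix (Fin 2) (Fin 2) ℤ) := {g | g.det = 1 ∧ 2 ∣ g 1 0}

/-- `ω = [[0, -1], [1, 0]]`. -/
def omegaMat : Matrix (Fin 2) (Fin 2) ℤ := !![0, -1; 1, 0]

/-- `n₁ = [[1, 1], [0, 1]]`. -/
def nOne : Matrix (Fin 2) (Fin 2) ℤ := !![1, 1; 0, 1]

/-- `d_t = diag(t, 1/t) ∈ SL₂(ℚ)`. -/
noncomputable def dMat (t : ℤ) : Matrix (Fin 2) (Fin 2) ℚ := !![(t : ℚ), 0; 0, (t : ℚ)⁻¹]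

/-- Cast an integral 2×2 matrix to a rational one. -/
def liftQ (A : Matrix (Fin 2) (Fin 2) ℤ) : Matrix (Fin 2) (Fin 2) ℚ :=
  A.map (Int.cast : ℤ → ℚ)

theorem dMat_inv {t : ℤ} (ht : (t : ℚ) ≠ 0) :
    (dMat t)⁻¹ = !![(t : ℚ)⁻¹, 0; 0, (t : ℚ)] := by
  apply Matrix.inv_eq_right_inv
  simp [dMat, ht, Matrix.one_fin_two]

theorem stmt_4 (t : ℤ) (ht : 0 < t) :
    (Even t → ∃ i₁ ∈ Iw2, ∃ i₂ ∈ Iw2,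
        liftQ omegaMat * dMat t * liftQ nOne * liftQ omegaMat
          = liftQ i₁ * (dMat t)⁻¹ * liftQ i₂) ∧
    (Odd t → ∃ i₁ ∈ Iw2, ∃ i₂ ∈ Iw2,
        liftQ omegaMat * dMat t * liftQ nOne * liftQ omegaMat
          = liftQ i₁ * liftQ omegaMat * (dMat t)⁻¹ * liftQ i₂) := by
  have h_ne : (t : ℚ) ≠ 0 := by exact_mod_cast ht.ne'
  refine ⟨fun h_even => ?_, fun h_odd => ?_⟩
  · refine ⟨!![1, 0; -t ^ 2, 1], ⟨by simp [Matrix.det_fin_two], ?_⟩,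
      !![-1, 0; 0, -1], ⟨by simp [Matrix.det_fin_two], by simp⟩, ?_⟩
    · simpa using (h_even.pow_of_ne_zero two_ne_zero).two_dvd
    · rw [dMat_inv h_ne]
      ext i j
      fin_cases i <;> fin_cases j <;>
        simp [liftQ, omegaMat, nOne, dMat, Matrix.mul_apply, Fin.sum_univ_two] <;>
        field_simp
  · refine ⟨!![1, 1; t ^ 2 - 1, t ^ 2], ⟨by simp [Matrix.det_fin_two], ?_⟩,
      !![2 * t ^ 2 - 1, -t ^ 2; 2, -1], ⟨by simp [Matrix.det_fin_two]; ring, by simp⟩, ?_⟩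
    · simpa using (h_odd.pow.sub_odd odd_one).two_dvd
    · rw [dMat_inv h_ne]
      ext i j
      fin_cases i <;> fin_cases j <;>
        simp [liftQ, omegaMat, nOne, dMat, Matrix.mul_apply, Fin.sum_univ_two] <;>
        field_simp <;> ring
end

section
/- Let t be a positive integer. If t is even then ω n₁ d_t ∈ I d_t I, and if t is odd then ω n₁ d_t ∈ I d_t ω I. -/
theorem stmt_5 (t : ℤ) (ht : 0 < t) :
    (Even t → ∃ i₁ ∈ Iw2, ∃ i₂ ∈ Iw2,
        liftQ omegaMat * liftQ nOne * dMat t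
          = liftQ i₁ * dMat t * liftQ i₂) ∧
    (Odd t → ∃ i₁ ∈ Iw2, ∃ i₂ ∈ Iw2,
        liftQ omegaMat * liftQ nOne * dMat t
          = liftQ i₁ * dMat t * liftQ omegaMat * liftQ i₂) := by
  have ht₀ : (t : ℚ) ≠ 0 := by exact_mod_cast ht.ne'
  refine ⟨fun h => ⟨!![1, -1; 0, 1], ?_, !![1, 0; t ^ 2, 1], ?_, ?_⟩,
    fun h => ⟨!![1, t ^ 2 - 1; 0, 1], ?_, !![t ^ 2, 1; t ^ 2 - 1, 1], ?_, ?_⟩⟩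
  · simp [Iw2, Matrix.det_fin_two]
  · simpa [Iw2, Matrix.det_fin_two] using dvd_pow h.two_dvd two_ne_zero
  · ext i j
    fin_cases i <;> fin_cases j <;>
      simp [liftQ, omegaMat, nOne, dMat, Matrix.mul_apply, Fin.sum_univ_two] <;>
      field_simp <;> ring
  · simp [Iw2, Matrix.det_fin_two]
  · simpa [Iw2, Matrix.det_fin_two] using (h.pow.sub_odd odd_one).two_dvd
  · ext i j
    fin_cases i <;> fin_cases j <;>
      simp [liftQ, omegaMat, nOne, dMat, Matrix.mul_apply, Fin.sum_univ_two] <;>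
      field_simp <;> ring
end

section
/- Let t be a positive integer. If t is odd then ω n₁ d_t n₁ ω ∈ I d_t⁻¹ I, and if t is even then ω n₁ d_t n₁ ω ∈ I ω d_t⁻¹ I. -/
theorem stmt_6 (t : ℤ) (ht : 0 < t) :
    (Odd t → ∃ i₁ ∈ Iw2, ∃ i₂ ∈ Iw2,
        liftQ omegaMat * liftQ nOne * dMat t * liftQ nOne * liftQ omegaMat
          = liftQ i₁ * (dMat t)⁻¹ * liftQ i₂) ∧
    (Even t → ∃ i₁ ∈ Iw2, ∃ i₂ ∈ Iw2,
        liftQ omegaMat * liftQ nOne * dMat t * liftQ nOne * liftQ omegaMat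
          = liftQ i₁ * liftQ omegaMat * (dMat t)⁻¹ * liftQ i₂) := by
  have ht' : (t : ℚ) ≠ 0 := by exact_mod_cast ht.ne'
  have dMat_inv : (dMat t)⁻¹ = !![(t : ℚ)⁻¹, 0; 0, (t : ℚ)] := by
    apply Matrix.inv_eq_right_inv
    ext i j
    fin_cases i <;> fin_cases j <;> simp [dMat, ht']
  rw [dMat_inv]
  refine ⟨fun h => ⟨!![-1, 0; t ^ 2 + 1, -1], ⟨?_, ?_⟩, 1, ⟨?_, ?_⟩, ?_⟩,
    fun h => ⟨!![1, -1; -t ^ 2, 1 + t ^ 2], ⟨?_, ?_⟩, !![1, -t ^ 2; 0, 1], ⟨?_, ?_⟩, ?_⟩⟩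
  · simp [Matrix.det_fin_two]
  · simpa using (h.pow.add_one : Even (t ^ 2 + 1)).two_dvd
  · simp
  · simp
  · ext i j
    fin_cases i <;> fin_cases j <;>
      simp [liftQ, omegaMat, nOne, dMat, Matrix.mul_apply, Fin.sum_univ_two] <;>
      field_simp
  · simp [Matrix.det_fin_two]
  · simpa using (h.pow_of_ne_zero two_ne_zero : Even (t ^ 2)).two_dvd
  · simp [Matrix.det_fin_two]
  · simp
  · ext i j
    fin_cases i <;> fin_cases j <;>
      simp [liftQ, omegaMat, nOne, dMat, Matrix.mul_apply, Fin.sum_univ_two] <;>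
      field_simp <;> ring
end

section
/- Let t be a nonzero integer with ν₂(t) ≥ 1 and let d be a nonzero rational number; write n_t = ν₂(t) and n_d = ν₂(d). Suppose x, y, l₁, l₂ ∈ ℤ satisfy d⁻¹y − x = t·l₁ and −d·x − y = t·l₂. If n_d − n_t ≥ 0, or n_d + n_t ≤ 0, or (n_d − n_t ≤ −2 and n_d + n_t ≥ 2), then x·y/t is an integer. (Equivalently ψ((1/t)·q_{g₀}((x, y))) = 1 for ψ(u) = e^{2πiκu}, κ ∈ {1, −1}, where q_{g₀}((x, y)) = −xy for g₀ = diag(d, d⁻¹)·[[0, −1], [1, 0]].) -/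
/- `padicValRat 2` is the 2-adic valuation `ν₂` on the nonzero rationals
(with `ν₂(2) = 1`). -/

/-- If `2 ^ a` divides `p * S` and the 2-adic valuation of `p` is at most `a - 2`,
then `4` divides `S`. -/
theorem four_dvd_of_two_pow_dvd_mul {a : ℕ} {p S : ℤ} (hp : p ≠ 0)
    (hv : padicValInt 2 p + 2 ≤ a) (h : (2 : ℤ) ^ a ∣ p * S) : (4 : ℤ) ∣ S := by
  rcases eq_or_ne S 0 with rfl | hS
  · exact dvd_zero _
  have h1 := ((padicValInt_dvd_iff (p := 2) a (p * S)).1 (by exact_mod_cast h)).resolve_left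
    (mul_ne_zero hp hS)
  rw [padicValInt.mul hp hS] at h1
  have h2 := (padicValInt_dvd_iff (p := 2) 2 S).2 (Or.inr (by omega))
  norm_num at h2
  exact h2

/-- The integral form of the statement, with `d = p / q` and `t = 2 ^ a * s`. -/
theorem dvd_mul_of_dvd_sub_of_dvd_add {a : ℕ} {s p q x y : ℤ} (hs : IsCoprime s 2)
    (hp : p ≠ 0) (hq : q ≠ 0)
    (hD : 2 ^ a * s ∣ q * (y - x)) (hS : 2 ^ a * s ∣ p * (x + y))
    (h : (2 : ℤ) ^ a ∣ p ∨ (2 : ℤ) ^ a ∣ q ∨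
      (padicValInt 2 p + 2 ≤ a ∧ padicValInt 2 q + 2 ≤ a)) :
    2 ^ a * s ∣ (q * x) * (p * y) := by
  refine IsCoprime.mul_dvd hs.symm.pow_left ?_ ?_
  · rcases h with h | h | ⟨h1, h2⟩
    · exact (h.mul_right _).mul_left _
    · exact (h.mul_right _).mul_right _
    · have hD' := dvd_of_mul_right_dvd hD
      have hS' := dvd_of_mul_right_dvd hS
      obtain ⟨u, hu⟩ := four_dvd_of_two_pow_dvd_mul hp h1 hS'
      obtain ⟨v, hv⟩ := four_dvd_of_two_pow_dvd_mul hq h2 hD'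
      have key : (q * x) * (p * y) = (p * (x + y)) * (q * u) - (q * (y - x)) * (p * v) := by
        refine mul_left_cancel₀ (four_ne_zero : (4 : ℤ) ≠ 0) ?_
        linear_combination (p * q * (x + y)) * hu - (p * q * (y - x)) * hv
      rw [key]
      exact dvd_sub (hS'.mul_right _) (hD'.mul_right _)
  · have hD' := dvd_of_mul_left_dvd hD
    have hS' := dvd_of_mul_left_dvd hS
    refine IsCoprime.dvd_of_dvd_mul_left hs ?_
    have key : 2 * ((q * x) * (p * y)) = (p * (x + y)) * (q * y) - (q * (y - x)) * (p * y) := by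
      ring
    rw [key]
    exact dvd_sub (hS'.mul_right _) (hD'.mul_right _)

theorem stmt_13 (t : ℤ) (ht : t ≠ 0) (hvt : 1 ≤ padicValRat 2 (t : ℚ))
    (d : ℚ) (hd : d ≠ 0) (x y l₁ l₂ : ℤ)
    (h₁ : d⁻¹ * (y : ℚ) - (x : ℚ) = (t : ℚ) * (l₁ : ℚ))
    (h₂ : -d * (x : ℚ) - (y : ℚ) = (t : ℚ) * (l₂ : ℚ))
    (hcase :
      padicValRat 2 d - padicValRat 2 (t : ℚ) ≥ 0 ∨
      padicValRat 2 d + padicValRat 2 (t : ℚ) ≤ 0 ∨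
      (padicValRat 2 d - padicValRat 2 (t : ℚ) ≤ -2 ∧
        padicValRat 2 d + padicValRat 2 (t : ℚ) ≥ 2)) :
    ∃ k : ℤ, (x : ℚ) * (y : ℚ) / (t : ℚ) = (k : ℚ) := by
  have hp : d.num ≠ 0 := Rat.num_ne_zero.2 hd
  have hq : (d.den : ℤ) ≠ 0 := by exact_mod_cast d.den_nz
  have hcop : IsCoprime d.num (d.den : ℤ) := by
    rw [Int.isCoprime_iff_gcd_eq_one]
    exact d.reduced
  have hval : padicValRat 2 d = padicValInt 2 d.num - padicValInt 2 (d.den : ℤ) := by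
    simp [padicValRat]
  have hmin : padicValInt 2 d.num = 0 ∨ padicValInt 2 (d.den : ℤ) = 0 := by
    by_contra! hne
    have h2p := (padicValInt_dvd_iff (p := 2) 1 d.num).2 (Or.inr (by omega))
    have h2q := (padicValInt_dvd_iff (p := 2) 1 (d.den : ℤ)).2 (Or.inr (by omega))
    have := hcop.isUnit_of_dvd' h2p h2q
    rw [Int.isUnit_iff] at this
    norm_num at this
  rw [padicValRat.of_int] at hcase
  rw [hval] at hcase
  obtain ⟨p, hpd⟩ : ∃ p, p = d.num := ⟨_, rfl⟩
  obtain ⟨q, hqd⟩ : ∃ q : ℤ, q = d.den := ⟨_, rfl⟩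
  have hd' : d = (p : ℚ) / q := by
    rw [hpd, hqd]
    exact (Rat.num_div_den d).symm
  rw [← hpd] at hp hcop hmin hcase
  rw [← hqd] at hq hcop hmin hcase
  have hpQ : (p : ℚ) ≠ 0 := by exact_mod_cast hp
  have hqQ : (q : ℚ) ≠ 0 := by exact_mod_cast hq
  have e₁ : q * y - p * x = p * (t * l₁) := by
    rw [hd'] at h₁
    field_simp at h₁
    have h₁' : (q : ℚ) * y - p * x = p * (t * l₁) := by linear_combination h₁
    exact_mod_cast h₁'
  have e₂ : -(p * x) - q * y = q * (t * l₂) := by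
    rw [hd'] at h₂
    field_simp at h₂
    have h₂' : -((p : ℚ) * x) - q * y = q * (t * l₂) := by linear_combination h₂
    exact_mod_cast h₂'
  obtain ⟨y', rfl⟩ : p ∣ y :=
    hcop.dvd_of_dvd_mul_left ⟨x + t * l₁, by linear_combination e₁⟩
  obtain ⟨x', rfl⟩ : q ∣ x :=
    hcop.symm.dvd_of_dvd_mul_left ⟨-(p * y') - t * l₂, by linear_combination -e₂⟩
  have hD : t ∣ q * (y' - x') :=
    ⟨l₁, mul_left_cancel₀ hp (by linear_combination e₁)⟩
  have hS : t ∣ p * (x' + y') :=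
    ⟨-l₂, mul_left_cancel₀ hq (by linear_combination -e₂)⟩
  obtain ⟨s, hs⟩ : (2 : ℤ) ^ padicValInt 2 t ∣ t := by exact_mod_cast padicValInt_dvd (p := 2) t
  have hs2 : IsCoprime s 2 := by
    refine ((Int.prime_two.coprime_iff_not_dvd).2 ?_).symm
    rintro ⟨r, rfl⟩
    have := ((padicValInt_dvd_iff (p := 2) (padicValInt 2 t + 1) t).1
      ⟨r, by push_cast; rw [pow_succ]; linear_combination hs⟩).resolve_left ht
    omega
  have hcase' : (2 : ℤ) ^ padicValInt 2 t ∣ p ∨ (2 : ℤ) ^ padicValInt 2 t ∣ q ∨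
      (padicValInt 2 p + 2 ≤ padicValInt 2 t ∧ padicValInt 2 q + 2 ≤ padicValInt 2 t) := by
    rcases hcase with h | h | h
    · left
      exact_mod_cast (padicValInt_dvd_iff (p := 2) (padicValInt 2 t) p).2 (Or.inr (by omega))
    · right; left
      exact_mod_cast (padicValInt_dvd_iff (p := 2) (padicValInt 2 t) q).2 (Or.inr (by omega))
    · right; right
      omega
  have hdvd : t ∣ (q * x') * (p * y') := by
    have := dvd_mul_of_dvd_sub_of_dvd_add hs2 hp hq (hs ▸ hD) (hs ▸ hS) hcase'
    rwa [← hs] at this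
  obtain ⟨k, hk⟩ := hdvd
  have htQ : (t : ℚ) ≠ 0 := by exact_mod_cast ht
  refine ⟨k, ?_⟩
  rw [div_eq_iff htQ, mul_comm (k : ℚ)]
  exact_mod_cast hk
end

section
/- Let t be a nonzero integer with ν₂(t) ≥ 1 and let d be a nonzero rational number; write n_t = ν₂(t) and n_d = ν₂(d), and let x, y, l₁, l₂ ∈ ℤ. (i) If n_d − n_t = −1 and (2d)⁻¹y − x = t·l₁ and −2d·x − y = t·l₂, then x·y/t is an integer. (ii) If n_d + n_t = 1 and 2d⁻¹y − x = t·l₁ and −(d/2)·x − y = t·l₂, then x·y/t is an integer. -/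
/- `padicValRat 2` is the 2-adic valuation `ν₂` on the nonzero rationals
(with `ν₂(2) = 1`). -/

/-- If `t` divides `2 * z` and the full power of `2` in `t` divides `z`, then `t` divides `z`. -/
theorem dvd_of_dvd_two_mul {t z : ℤ} (ht : t ≠ 0) (h : t ∣ 2 * z)
    (hz : (2 : ℤ) ^ padicValInt 2 t ∣ z) : t ∣ z := by
  obtain ⟨u, hu⟩ : (2 : ℤ) ^ padicValInt 2 t ∣ t := by
    exact_mod_cast padicValInt_dvd (p := 2) t
  obtain ⟨w, hw⟩ := hz
  obtain ⟨m, hm⟩ := h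
  have hpow : (2 : ℤ) ^ padicValInt 2 t ≠ 0 := by positivity
  have hodd : ¬ (2 : ℤ) ∣ u := by
    rintro ⟨v, hv⟩
    have hdvd : ((2 : ℕ) : ℤ) ^ (padicValInt 2 t + 1) ∣ t :=
      ⟨v, by rw [pow_succ]; push_cast; linear_combination hu + 2 ^ padicValInt 2 t * hv⟩
    rcases (padicValInt_dvd_iff _ _).1 hdvd with h0 | h0
    · exact ht h0
    · omega
  have key : 2 * w = u * m := mul_left_cancel₀ hpow (by
    linear_combination hm - 2 * hw + m * hu)
  rcases Int.prime_two.dvd_or_dvd ⟨w, key.symm⟩ with h2 | ⟨k, hk⟩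
  · exact absurd h2 hodd
  · refine ⟨k, ?_⟩
    have : 2 * z = 2 * (t * k) := by rw [hm, hk]; ring
    linarith

/-- If `y / e - x` and `-e * x - y` are integer multiples of `t`, and the valuation of `e` at `2`
is at least that of `t` or at most its negative, then `t` divides `x * y`. -/
theorem exists_int_mul_div_eq {t : ℤ} (ht : t ≠ 0) {e : ℚ} (he : e ≠ 0) {x y l₁ l₂ : ℤ}
    (hv : padicValRat 2 (t : ℚ) ≤ padicValRat 2 e ∨ padicValRat 2 e ≤ -padicValRat 2 (t : ℚ))
    (h₁ : e⁻¹ * (y : ℚ) - x = t * l₁) (h₂ : -e * (x : ℚ) - y = t * l₂) :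
    ∃ k : ℤ, (x : ℚ) * y / t = k := by
  have hb : (e.den : ℚ) ≠ 0 := by exact_mod_cast e.den_ne_zero
  have hnum : (e.num : ℚ) = e * e.den := (Rat.mul_den_eq_num e).symm
  have e₁ : (e.den : ℤ) * y = e.num * (x + t * l₁) := by
    have : (e.den : ℚ) * y = e.num * (x + t * l₁) := by
      rw [hnum, ← h₁]; field_simp; ring
    exact_mod_cast this
  have e₂ : -e.num * x - e.den * y = e.den * (t * l₂) := by
    have : -(e.num : ℚ) * x - e.den * y = e.den * (t * l₂) := by
      rw [hnum, ← h₂]; ring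
    exact_mod_cast this
  have hcop : IsCoprime e.num (e.den : ℤ) := Rat.isCoprime_num_den e
  have h2xy : t ∣ 2 * (x * y) := by
    obtain ⟨r, s, hrs⟩ := hcop
    refine ⟨-r * (e.num * l₁ + e.den * l₂) * y + s * (e.num * l₁ - e.den * l₂) * x, ?_⟩
    linear_combination (-2 * x * y) * hrs + (s * x - r * y) * e₁ - (r * y + s * x) * e₂
  have hdvd : (2 : ℤ) ^ padicValInt 2 t ∣ x * y := by
    rw [padicValRat.of_int, padicValRat_def] at hv
    rcases hv with hv | hv
    · have ha : (2 : ℤ) ^ padicValInt 2 t ∣ e.num := by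
        exact_mod_cast (padicValInt_dvd_iff (p := 2) _ _).2 (Or.inr (by omega))
      exact ((hcop.of_isCoprime_of_dvd_left ha).dvd_of_dvd_mul_left
        (e₁ ▸ ha.mul_right _)).mul_left x
    · have hd : (2 : ℤ) ^ padicValInt 2 t ∣ (e.den : ℤ) := by
        exact_mod_cast (padicValNat_dvd_iff (p := 2) _ _).2 (Or.inr (by omega))
      refine ((hcop.symm.of_isCoprime_of_dvd_left hd).dvd_of_dvd_mul_left ?_).mul_right y
      have : e.num * x = e.den * (-y - t * l₂) := by linear_combination -e₂
      exact this ▸ hd.mul_right _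
  obtain ⟨k, hk⟩ := dvd_of_dvd_two_mul ht h2xy hdvd
  refine ⟨k, ?_⟩
  have ht' : (t : ℚ) ≠ 0 := by exact_mod_cast ht
  rw [div_eq_iff ht', mul_comm (k : ℚ)]
  exact_mod_cast hk

theorem stmt_14 (t : ℤ) (ht : t ≠ 0) (hvt : 1 ≤ padicValRat 2 (t : ℚ))
    (d : ℚ) (hd : d ≠ 0) (x y l₁ l₂ : ℤ) :
    ((padicValRat 2 d - padicValRat 2 (t : ℚ) = -1 →
        (2 * d)⁻¹ * (y : ℚ) - (x : ℚ) = (t : ℚ) * (l₁ : ℚ) →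
        -(2 * d) * (x : ℚ) - (y : ℚ) = (t : ℚ) * (l₂ : ℚ) →
        ∃ k : ℤ, (x : ℚ) * (y : ℚ) / (t : ℚ) = (k : ℚ)) ∧
     (padicValRat 2 d + padicValRat 2 (t : ℚ) = 1 →
        2 * d⁻¹ * (y : ℚ) - (x : ℚ) = (t : ℚ) * (l₁ : ℚ) →
        -(d / 2) * (x : ℚ) - (y : ℚ) = (t : ℚ) * (l₂ : ℚ) →
        ∃ k : ℤ, (x : ℚ) * (y : ℚ) / (t : ℚ) = (k : ℚ))) := by
  have h2 : padicValRat 2 (2 : ℚ) = 1 := by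
    exact_mod_cast padicValRat.self (p := 2) one_lt_two
  refine ⟨fun hv h₁ h₂ => ?_, fun hv h₁ h₂ => ?_⟩
  · refine exists_int_mul_div_eq ht (e := 2 * d) (by positivity) (Or.inl ?_) h₁ h₂
    rw [padicValRat.mul two_ne_zero hd, h2]
    omega
  · refine exists_int_mul_div_eq ht (e := d / 2) (l₁ := l₁) (by positivity) (Or.inr ?_) ?_ h₂
    · rw [padicValRat.div hd two_ne_zero, h2]
      omega
    · rw [inv_div, div_eq_mul_inv]
      exact h₁
end

section
/- Let e ∈ ℤ and let L₁ = {(x, x*) ∈ ℚ₂^{2m} : x_i ∈ 2^{⌈e/2⌉}ℤ₂ and x*_i ∈ 2^{⌊e/2⌋}ℤ₂ for all i}. Let g = ω·Δ ∈ Sp_{2m}(ℚ₂), where ω ∈ 𝔚 and Δ = diag(2^{k₁},…,2^{k_m}, 2^{−k₁},…,2^{−k_m}) with k₁,…,k_m ∈ ℤ (so g lies in the extended affine Weyl group 𝔚^{eaff} at 2). Then q_g(l) ∈ 2^e ℤ₂ for every l ∈ L₁; consequently ψ(q_g(l)) = 1 for every character ψ of the additive group of ℚ₂ that is trivial on 2^e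 ℤ₂. -/
open Matrix

/-- `x ∈ 2^e ℤ₂` inside `ℚ₂`. -/
def inTwoPowLattice (e : ℤ) (x : ℚ_[2]) : Prop :=
  ∃ z : ℤ_[2], x = (2 : ℚ_[2]) ^ e * (z : ℚ_[2])

/-- `B((x,x*),(y,y*)) = Σ_{i=1}^m x_i y*_i`. -/
noncomputable def BfP (m : ℕ) (w w' : (Fin m ⊕ Fin m) → ℚ_[2]) : ℚ_[2] :=
  ∑ i : Fin m, w (Sum.inl i) * w' (Sum.inr i)

/-- Projection of `w = (x, x*)` to `(x, 0)`. -/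
noncomputable def xpart (m : ℕ) (w : (Fin m ⊕ Fin m) → ℚ_[2]) : (Fin m ⊕ Fin m) → ℚ_[2] :=
  fun p => match p with
  | Sum.inl i => w (Sum.inl i)
  | Sum.inr _ => 0

/-- Projection of `w = (x, x*)` to `(0, x*)`. -/
noncomputable def spart (m : ℕ) (w : (Fin m ⊕ Fin m) → ℚ_[2]) : (Fin m ⊕ Fin m) → ℚ_[2] :=
  fun p => match p with
  | Sum.inl _ => 0
  | Sum.inr i => w (Sum.inr i)

/-- `q_g((x,x*)) = ½B(xa, xb) + ½B(x*c, x*d) + B(x*c, xb)`, for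
`g = [[a, b], [c, d]]` acting on row vectors on the right. -/
noncomputable def qform (m : ℕ) (g : Matrix (Fin m ⊕ Fin m) (Fin m ⊕ Fin m) ℚ_[2])
    (w : (Fin m ⊕ Fin m) → ℚ_[2]) : ℚ_[2] :=
  BfP m (Matrix.vecMul (xpart m w) g) (Matrix.vecMul (xpart m w) g) / 2
    + BfP m (Matrix.vecMul (spart m w) g) (Matrix.vecMul (spart m w) g) / 2
    + BfP m (Matrix.vecMul (spart m w) g) (Matrix.vecMul (xpart m w) g)

theorem vecMul_permWeyl_inl {m : ℕ} {R : Type*} [CommRing R] (s : Equiv.Perm (Fin m))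
    (v : Fin m ⊕ Fin m → R) (j : Fin m) :
    (v ᵥ* permWeyl m R s) (Sum.inl j) = v (Sum.inl (s.symm j)) := by
  simp [vecMul, dotProduct, permWeyl, ← Equiv.eq_symm_apply]

theorem vecMul_permWeyl_inr {m : ℕ} {R : Type*} [CommRing R] (s : Equiv.Perm (Fin m))
    (v : Fin m ⊕ Fin m → R) (j : Fin m) :
    (v ᵥ* permWeyl m R s) (Sum.inr j) = v (Sum.inr (s.symm j)) := by
  simp [vecMul, dotProduct, permWeyl, ← Equiv.eq_symm_apply]

theorem vecMul_signWeyl_inl {m : ℕ} {R : Type*} [CommRing R] (S : Finset (Fin m))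
    (v : Fin m ⊕ Fin m → R) (j : Fin m) :
    (v ᵥ* signWeyl m R S) (Sum.inl j) = if j ∈ S then v (Sum.inr j) else v (Sum.inl j) := by
  have h_mem (i : Fin m) : i ∈ S ∧ i = j ↔ j ∈ S ∧ i = j := by grind
  have h_notMem (i : Fin m) : i ∉ S ∧ i = j ↔ j ∉ S ∧ i = j := by grind
  by_cases hj : j ∈ S <;> simp [vecMul, dotProduct, signWeyl, h_mem, h_notMem, hj]

theorem vecMul_signWeyl_inr {m : ℕ} {R : Type*} [CommRing R] (S : Finset (Fin m))
    (v : Fin m ⊕ Fin m → R) (j : Fin m) :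
    (v ᵥ* signWeyl m R S) (Sum.inr j) = if j ∈ S then -v (Sum.inl j) else v (Sum.inr j) := by
  have h_mem (i : Fin m) : i ∈ S ∧ i = j ↔ j ∈ S ∧ i = j := by grind
  have h_notMem (i : Fin m) : i ∉ S ∧ i = j ↔ j ∉ S ∧ i = j := by grind
  by_cases hj : j ∈ S <;> simp [vecMul, dotProduct, signWeyl, h_mem, h_notMem, hj]

/-- On the extended affine Weyl group `q_g` is a sum of terms `-x*_i x_i`: the two halved
terms vanish and the torus part cancels. -/
theorem qform_weyl_mul_diagonal {m : ℕ} (s : Equiv.Perm (Fin m)) (S : Finset (Fin m))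
    (k : Fin m → ℤ) (l : Fin m ⊕ Fin m → ℚ_[2]) :
    qform m (permWeyl m ℚ_[2] s * signWeyl m ℚ_[2] S * Matrix.diagonal
        (Sum.elim (fun i => (2 : ℚ_[2]) ^ (k i)) fun i => (2 : ℚ_[2]) ^ (-(k i)))) l =
      ∑ j ∈ S, -(l (Sum.inr (s.symm j)) * l (Sum.inl (s.symm j))) := by
  have hk (j : Fin m) : (2 : ℚ_[2]) ^ k j * 2 ^ (-k j) = 1 := by
    rw [← zpow_add₀ two_ne_zero, add_neg_cancel, zpow_zero]
  simp only [qform, BfP, ← vecMul_vecMul, vecMul_diagonal, Sum.elim_inl, Sum.elim_inr,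
    vecMul_signWeyl_inl, vecMul_signWeyl_inr, vecMul_permWeyl_inl, vecMul_permWeyl_inr,
    xpart, spart]
  rw [Finset.sum_eq_zero, Finset.sum_eq_zero, zero_div, zero_add, zero_add,
    ← Finset.sum_subset (Finset.subset_univ S) fun j _ hj => by simp [hj]]
  · refine Finset.sum_congr rfl fun j hj => ?_
    rw [if_pos hj, if_pos hj]
    linear_combination (-(l (Sum.inr (s.symm j)) * l (Sum.inl (s.symm j)))) * hk j
  all_goals
    intro j _
    split_ifs <;> simp

theorem inTwoPowLattice.neg {e : ℤ} {x : ℚ_[2]} (hx : inTwoPowLattice e x) :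
    inTwoPowLattice e (-x) := by
  obtain ⟨z, rfl⟩ := hx
  exact ⟨-z, by push_cast; ring⟩

theorem inTwoPowLattice.mul {a b : ℤ} {x y : ℚ_[2]} (hx : inTwoPowLattice a x)
    (hy : inTwoPowLattice b y) : inTwoPowLattice (a + b) (x * y) := by
  obtain ⟨z, rfl⟩ := hx
  obtain ⟨w, rfl⟩ := hy
  exact ⟨z * w, by rw [zpow_add₀ two_ne_zero]; push_cast; ring⟩

theorem inTwoPowLattice_sum {ι : Type*} {e : ℤ} (s : Finset ι) (f : ι → ℚ_[2])
    (hf : ∀ i ∈ s, inTwoPowLattice e (f i)) : inTwoPowLattice e (∑ i ∈ s, f i) := by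
  refine Finset.sum_induction f (inTwoPowLattice e) ?_ ⟨0, by simp⟩ hf
  rintro _ _ ⟨z, rfl⟩ ⟨w, rfl⟩
  exact ⟨z + w, by push_cast; ring⟩

/-- For `g = ω Δ` in the extended affine Weyl group at 2 and
`l ∈ L₁ = 2^{⌈e/2⌉}ℤ₂^m ⊕ 2^{⌊e/2⌋}ℤ₂^m`, one has `q_g(l) ∈ 2^e ℤ₂`;
consequently `ψ(q_g(l)) = 1` for every additive character `ψ` of `ℚ₂`
trivial on `2^e ℤ₂`. -/
theorem stmt_15 (m : ℕ) (hm : 1 ≤ m) (e : ℤ)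
    (g : Matrix (Fin m ⊕ Fin m) (Fin m ⊕ Fin m) ℚ_[2])
    (hg : ∃ w ∈ WeylSet m ℚ_[2], ∃ k : Fin m → ℤ,
        g = w * Matrix.diagonal
              (Sum.elim (fun i => (2 : ℚ_[2]) ^ (k i)) fun i => (2 : ℚ_[2]) ^ (-(k i)))) :
    (∀ l : (Fin m ⊕ Fin m) → ℚ_[2],
        (∀ i : Fin m, inTwoPowLattice ((e + 1) / 2) (l (Sum.inl i)) ∧
            inTwoPowLattice (e / 2) (l (Sum.inr i))) →
        inTwoPowLattice e (qform m g l)) ∧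
    (∀ ψ : ℚ_[2] → ℂˣ, (∀ a b, ψ (a + b) = ψ a * ψ b) →
        (∀ x, inTwoPowLattice e x → ψ x = 1) →
        ∀ l : (Fin m ⊕ Fin m) → ℚ_[2],
          (∀ i : Fin m, inTwoPowLattice ((e + 1) / 2) (l (Sum.inl i)) ∧
              inTwoPowLattice (e / 2) (l (Sum.inr i))) →
          ψ (qform m g l) = 1) := by
  suffices h : ∀ l : (Fin m ⊕ Fin m) → ℚ_[2],
      (∀ i : Fin m, inTwoPowLattice ((e + 1) / 2) (l (Sum.inl i)) ∧
        inTwoPowLattice (e / 2) (l (Sum.inr i))) → inTwoPowLattice e (qform m g l) from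
    ⟨h, fun ψ _ hψ l hl => hψ _ (h l hl)⟩
  intro l hl
  obtain ⟨_, ⟨s, S, rfl⟩, k, rfl⟩ := hg
  rw [qform_weyl_mul_diagonal]
  refine inTwoPowLattice_sum S _ fun j _ => ?_
  have he : e / 2 + (e + 1) / 2 = e := by omega
  have hmul := (hl (s.symm j)).2.mul (hl (s.symm j)).1
  rw [he] at hmul
  exact hmul.neg
end

section
/- Let e be an even integer, and let t, d ∈ ℚ₂ be nonzero with v(t) ≥ 1; write n_t = v(t) and n_d = v(d). Suppose x, y, l₁, l₂ ∈ 2^{e/2}ℤ₂ satisfy d⁻¹y − x = t·l₁ and −d·x − y = t·l₂. If n_d − n_t ≥ 0, or n_d + n_t ≤ 0, or (n_d − n_t ≤ −2 and n_d + n_t ≥ 2), then x·y·t⁻¹ ∈ 2^e ℤ₂. -/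
theorem Padic.exists_coe_eq_of_valuation_nonneg {p : ℕ} [Fact p.Prime] {a : ℚ_[p]}
    (ha : 0 ≤ a.valuation) : ∃ z : ℤ_[p], a = z :=
  ⟨⟨a, (Padic.norm_le_one_iff_val_nonneg a).2 ha⟩, rfl⟩

/- `Padic.valuation` is the additive 2-adic valuation `v` on `ℚ₂` with `v(2) = 1`. -/

theorem stmt_17 (e : ℤ) (he : Even e) (t d : ℚ_[2]) (ht : t ≠ 0) (hd : d ≠ 0)
    (hvt : 1 ≤ t.valuation) (x y l₁ l₂ : ℚ_[2])
    (hx : inTwoPowLattice (e / 2) x) (hy : inTwoPowLattice (e / 2) y)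
    (hl₁ : inTwoPowLattice (e / 2) l₁) (hl₂ : inTwoPowLattice (e / 2) l₂)
    (h₁ : d⁻¹ * y - x = t * l₁) (h₂ : -d * x - y = t * l₂)
    (hcase :
      d.valuation - t.valuation ≥ 0 ∨
      d.valuation + t.valuation ≤ 0 ∨
      (d.valuation - t.valuation ≤ -2 ∧ d.valuation + t.valuation ≥ 2)) :
    inTwoPowLattice e (x * y * t⁻¹) := by
  obtain ⟨k, rfl⟩ := he
  have hk : (k + k) / 2 = k := by omega
  rw [hk] at hx hy hl₁ hl₂
  obtain ⟨X, hX⟩ := hx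
  obtain ⟨Y, hY⟩ := hy
  obtain ⟨L₁, hL₁⟩ := hl₁
  obtain ⟨L₂, hL₂⟩ := hl₂
  have h2 : (2 : ℚ_[2]) ≠ 0 := two_ne_zero
  have hpow : (2 : ℚ_[2]) ^ (k + k) = 2 ^ k * 2 ^ k := zpow_add₀ h2 k k
  have hv4 : (4 : ℚ_[2]).valuation = 2 := by
    have h4 : (4 : ℚ_[2]) = ((2 : ℕ) : ℚ_[2]) ^ 2 := by norm_num
    rw [h4, Padic.valuation_pow, Padic.valuation_p]
    norm_num
  have h4 : (4 : ℚ_[2]) ≠ 0 := by norm_num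
  unfold inTwoPowLattice
  rw [hpow]
  rcases hcase with h | h | ⟨h, h'⟩
  · obtain ⟨u, hu⟩ : ∃ u : ℤ_[2], d * t⁻¹ = u := by
      apply Padic.exists_coe_eq_of_valuation_nonneg
      rw [Padic.valuation_mul hd (inv_ne_zero ht), Padic.valuation_inv]
      omega
    refine ⟨X * (-u * X - L₂), ?_⟩
    have hy' : y = -d * x - t * l₂ := by linear_combination -h₂
    push_cast
    rw [← hu, hy', hX, hL₂]
    field_simp
  · obtain ⟨u, hu⟩ : ∃ u : ℤ_[2], d⁻¹ * t⁻¹ = u := by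
      apply Padic.exists_coe_eq_of_valuation_nonneg
      rw [Padic.valuation_mul (inv_ne_zero hd) (inv_ne_zero ht), Padic.valuation_inv,
        Padic.valuation_inv]
      omega
    refine ⟨(u * Y - L₁) * Y, ?_⟩
    have hx' : x = d⁻¹ * y - t * l₁ := by linear_combination -h₁
    push_cast
    rw [← hu, hx', hY, hL₁]
    field_simp
  · obtain ⟨u, hu⟩ : ∃ u : ℤ_[2], t * d * 4⁻¹ = u := by
      apply Padic.exists_coe_eq_of_valuation_nonneg
      rw [Padic.valuation_mul (mul_ne_zero ht hd) (inv_ne_zero h4), Padic.valuation_mul ht hd,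
        Padic.valuation_inv, hv4]
      omega
    obtain ⟨w, hw⟩ : ∃ w : ℤ_[2], t * d⁻¹ * 4⁻¹ = w := by
      apply Padic.exists_coe_eq_of_valuation_nonneg
      rw [Padic.valuation_mul (mul_ne_zero ht (inv_ne_zero hd)) (inv_ne_zero h4),
        Padic.valuation_mul ht (inv_ne_zero hd), Padic.valuation_inv, Padic.valuation_inv, hv4]
      omega
    refine ⟨w * L₂ ^ 2 - u * L₁ ^ 2, ?_⟩
    have hdd : d * d⁻¹ = 1 := mul_inv_cancel₀ hd
    have hy' : y = t * (d * l₁ - l₂) / 2 := by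
      linear_combination (-1 / 2) * h₂ + (d / 2) * h₁ - (y / 2) * hdd
    have hx' : x = -(t * (l₁ + d⁻¹ * l₂)) / 2 := by
      linear_combination (-1 / 2) * h₁ - (d⁻¹ / 2) * h₂ - (x / 2) * hdd
    push_cast
    rw [← hu, ← hw, hx', hy', hL₁, hL₂]
    field_simp
    ring
end
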